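/- arXiv:cs/9809118 — 9 statements merged into one kernel-verified Lean document; each statement's English description precedes it below -/
import Mathlib

section
/- Let A be a finite alphabet and L a language over A. The following are equivalent: (1) L is a finite union of sets ⟦w⟧ = {v : w ⊑ v} for words w ∈ A*; (2) L is regular and upward closed under the scattered-subword relation, i.e., ⟨L⟩ = L where ⟨L⟩ = ⋃_{w∈L} ⟦w⟧. -/
/-- The upward closure of a language under the scattered-subword relation. -/
def SubwordClosure {A : Type*} (L : Set (List A)) : Set (List A) :=
  {v | ∃ w ∈ L, w.Sublist v}

/-- A language is regular iff it is accepted by a DFA with a finite state set. -/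
def RegularLang {A : Type*} (L : Set (List A)) : Prop :=
  ∃ (σ : Type) (_ : Fintype σ) (M : DFA A σ), ∀ w : List A, M.eval w ∈ M.accept ↔ w ∈ L

theorem List.exists_suffix_sublist_append_iff {A : Type*} (w x : List A) :
    ∃ u, u <:+ w ∧ ∀ y, w.Sublist (x ++ y) ↔ u.Sublist y := by
  classical
  induction x generalizing w with
  | nil => exact ⟨w, w.suffix_refl, fun y => Iff.rfl⟩
  | cons a x ih =>
    cases w with
    | nil => exact ⟨[], List.suffix_refl _, fun y => by simp⟩
    | cons b w =>
      by_cases hab : b = a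
      · subst hab
        obtain ⟨u, hu, h⟩ := ih w
        exact ⟨u, hu.trans (List.suffix_cons b w), fun y => by simp [h]⟩
      · obtain ⟨u, hu, h⟩ := ih (b :: w)
        refine ⟨u, hu, fun y => ?_⟩
        rw [← h, List.cons_append, List.sublist_cons_iff]
        simp [hab]

theorem Language.isRegular_setOf_sublist {A : Type*} (w : List A) :
    Language.IsRegular ({v : List A | w.Sublist v} : Language A) := by
  apply Language.IsRegular.of_finite_range_leftQuotient
  refine ((w.tails.finite_toSet).image
    fun u => ({v : List A | u.Sublist v} : Language A)).subset ?_
  rintro _ ⟨x, rfl⟩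
  obtain ⟨u, hu, h⟩ := w.exists_suffix_sublist_append_iff x
  exact ⟨u, (List.mem_tails u w).2 hu, Set.ext fun y => (h y).symm⟩

theorem Language.isRegular_biUnion_finset {A ι : Type*} (s : Finset ι) (f : ι → Set (List A))
    (hf : ∀ i ∈ s, Language.IsRegular (f i)) :
    Language.IsRegular (⋃ i ∈ s, f i) := by
  classical
  induction s using Finset.induction_on with
  | empty =>
    refine ⟨Unit, inferInstance, ⟨fun _ _ => (), (), ∅⟩, ?_⟩
    refine Set.ext fun v => ⟨fun h => h.elim, fun h => ?_⟩
    simp at h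
  | insert i s _ ih =>
    rw [Finset.set_biUnion_insert]
    exact Language.IsRegular.add (hf i (Finset.mem_insert_self i s))
      (ih fun j hj => hf j (Finset.mem_insert_of_mem hj))

theorem List.finite_setOf_minimal_sublist {A : Type*} [Finite A] (L : Set (List A)) :
    {w | w ∈ L ∧ ∀ v ∈ L, v.Sublist w → v = w}.Finite := by
  have hpwo := Set.PartiallyWellOrderedOn.partiallyWellOrderedOn_sublistForall₂
    (· = ·) (Set.finite_univ (α := A)).partiallyWellOrderedOn
  refine IsAntichain.finite_of_partiallyWellOrderedOn (r := List.SublistForall₂ (· = ·)) ?_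
    (hpwo.mono fun _ _ _ _ => Set.mem_univ _)
  intro v hv w hw hne hvw
  obtain ⟨l, hl, hlw⟩ := List.sublistForall₂_iff.1 hvw
  rw [List.forall₂_eq_eq_eq] at hl
  subst hl
  exact hne (hw.2 v hv.1 hlw)

theorem List.exists_minimal_sublist {A : Type*} {L : Set (List A)} {v : List A} (hv : v ∈ L) :
    ∃ w, (w ∈ L ∧ ∀ u ∈ L, u.Sublist w → u = w) ∧ w.Sublist v := by
  obtain ⟨w, ⟨hwL, hwv⟩, hmin⟩ := (measure (List.length (α := A))).wf.has_min
    {w | w ∈ L ∧ w.Sublist v} ⟨v, hv, List.Sublist.refl v⟩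
  exact ⟨w, ⟨hwL, fun u hu huw => huw.eq_of_length_le
    (not_lt.1 (hmin u ⟨hu, huw.trans hwv⟩))⟩, hwv⟩

/-- A language `L` over a finite alphabet is a finite union of sets
`⟦w⟧ = {v | w ⊑ v}` if and only if `L` is regular and upward closed under
the scattered-subword relation. -/
theorem stmt0 {A : Type*} [Fintype A] (L : Set (List A)) :
    (∃ W : Finset (List A), L = ⋃ w ∈ W, {v : List A | w.Sublist v}) ↔
      (RegularLang L ∧ SubwordClosure L = L) := by
  constructor
  · rintro ⟨W, rfl⟩
    refine ⟨?_, Set.Subset.antisymm ?_ fun v hv => ⟨v, hv, List.Sublist.refl v⟩⟩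
    · obtain ⟨σ, _, M, hM⟩ := Language.isRegular_biUnion_finset W
        (fun w => ({v : List A | w.Sublist v} : Set (List A)))
        fun w _ => Language.isRegular_setOf_sublist w
      exact ⟨σ, inferInstance, M, fun w => Set.ext_iff.1 hM w⟩
    · rintro v ⟨u, hu, huv⟩
      simp only [Set.mem_iUnion, Set.mem_ofPred_eq] at hu ⊢
      obtain ⟨w, hw, hwu⟩ := hu
      exact ⟨w, hw, hwu.trans huv⟩
  · rintro ⟨-, hL⟩
    refine ⟨(List.finite_setOf_minimal_sublist L).toFinset, Set.ext fun v => ?_⟩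
    simp only [Set.mem_iUnion, Set.Finite.mem_toFinset, Set.mem_ofPred_eq, exists_prop]
    refine ⟨List.exists_minimal_sublist, ?_⟩
    rintro ⟨w, hw, hwv⟩
    rw [← hL]
    exact ⟨w, hw.1, hwv⟩
end

section
/- For every language L over a finite alphabet A and every m ≥ 0: if L^+(m) ≠ ∅ then L^+(m+1) is a proper subset of L^+(m), and if L^-(m) ≠ ∅ then L^-(m+1) is a proper subset of L^-(m). -/
/-- `LPlus L m` is the set of words `v` reachable from some `w₀ ∈ L` by an
`m`-alternating word extension chain with respect to `L`:
`w₀ ⊑ w₁ ⊑ ⋯ ⊑ w_m ⊑ v`, `w₀ ∈ L`, and `wᵢ ∈ L ↔ w_{i+1} ∉ L` for `i < m`. -/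
def LPlus {A : Type*} (L : Set (List A)) (m : ℕ) : Set (List A) :=
  {v | ∃ c : ℕ → List A, c 0 ∈ L ∧ (∀ i < m, (c i).Sublist (c (i + 1))) ∧
    (c m).Sublist v ∧ ∀ i < m, (c i ∈ L ↔ c (i + 1) ∉ L)}

/-- `LMinus L m` is defined like `LPlus L m` but requiring `w₀ ∉ L`. -/
def LMinus {A : Type*} (L : Set (List A)) (m : ℕ) : Set (List A) :=
  {v | ∃ c : ℕ → List A, c 0 ∉ L ∧ (∀ i < m, (c i).Sublist (c (i + 1))) ∧
    (c m).Sublist v ∧ ∀ i < m, (c i ∈ L ↔ c (i + 1) ∉ L)}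

theorem LMinus_eq_LPlus_compl {A : Type*} (L : Set (List A)) (m : ℕ) :
    LMinus L m = LPlus Lᶜ m := by
  ext v
  simp only [LMinus, LPlus, Set.mem_ofPred_eq, Set.mem_compl_iff, not_iff_not]

theorem LPlus_succ_subset {A : Type*} (L : Set (List A)) (m : ℕ) :
    LPlus L (m + 1) ⊆ LPlus L m := by
  rintro v ⟨c, h0, hsub, hv, halt⟩
  exact ⟨c, h0, fun i hi => hsub i (by omega), (hsub m (by omega)).trans hv,
    fun i hi => halt i (by omega)⟩

/-- A word of `LPlus L (m + 1)` is never a shortest word of `LPlus L m`. -/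
theorem exists_length_lt_of_mem_LPlus_succ {A : Type*} {L : Set (List A)} {m : ℕ} {v : List A}
    (hv : v ∈ LPlus L (m + 1)) : ∃ w ∈ LPlus L m, w.length < v.length := by
  obtain ⟨c, h0, hsub, hcv, halt⟩ := hv
  refine ⟨c m, ⟨c, h0, fun i hi => hsub i (by omega), List.Sublist.refl _,
    fun i hi => halt i (by omega)⟩, lt_of_lt_of_le ?_ hcv.length_le⟩
  refine lt_of_le_of_ne (hsub m (by omega)).length_le fun h => ?_
  have hm := halt m (by omega)
  rw [(hsub m (by omega)).eq_of_length h] at hm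
  exact iff_not_self hm

theorem LPlus_succ_ssubset {A : Type*} (L : Set (List A)) (m : ℕ) (h : (LPlus L m).Nonempty) :
    LPlus L (m + 1) ⊂ LPlus L m := by
  refine ⟨LPlus_succ_subset L m, fun hle => ?_⟩
  obtain ⟨v, hv, hmin⟩ := exists_minimalFor_of_wellFoundedLT (· ∈ LPlus L m) List.length h
  obtain ⟨w, hw, hlt⟩ := exists_length_lt_of_mem_LPlus_succ (hle hv)
  exact absurd (hmin hw hlt.le) (not_le.mpr hlt)

/-- If `L⁺(m) ≠ ∅` then `L⁺(m+1) ⊊ L⁺(m)`, and likewise for `L⁻`. -/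
theorem stmt3 {A : Type*} [Fintype A] (L : Set (List A)) (m : ℕ) :
    ((LPlus L m).Nonempty → LPlus L (m + 1) ⊂ LPlus L m) ∧
    ((LMinus L m).Nonempty → LMinus L (m + 1) ⊂ LMinus L m) := by
  rw [LMinus_eq_LPlus_compl, LMinus_eq_LPlus_compl]
  exact ⟨LPlus_succ_ssubset L m, LPlus_succ_ssubset Lᶜ m⟩
end

section
/- If L is a regular language over a finite alphabet A, then for every m ≥ 0 the languages L^+(m) and L^-(m) are regular. -/
theorem regularLang_iff_isRegular {A : Type*} {L : Set (List A)} :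
    RegularLang L ↔ Language.IsRegular (L : Language A) := by
  constructor
  · rintro ⟨σ, _, M, h⟩
    exact ⟨σ, inferInstance, M, Set.ext h⟩
  · rintro ⟨σ, _, M, h⟩
    exact ⟨σ, inferInstance, M, fun w => Set.ext_iff.mp h w⟩

theorem RegularLang.compl {A : Type*} {L : Set (List A)} (h : RegularLang L) :
    RegularLang Lᶜ :=
  regularLang_iff_isRegular.mpr (regularLang_iff_isRegular.mp h).compl

theorem RegularLang.inter {A : Type*} {L K : Set (List A)} (hL : RegularLang L)
    (hK : RegularLang K) : RegularLang (L ∩ K) :=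
  regularLang_iff_isRegular.mpr
    ((regularLang_iff_isRegular.mp hL).inf (regularLang_iff_isRegular.mp hK))

/-- The automaton tracking all states that `M` reaches on scattered subwords of the input. -/
def DFA.superword {A σ : Type*} (M : DFA A σ) : DFA A (Set σ) where
  step S a := S ∪ (fun s => M.step s a) '' S
  start := {M.start}
  accept := {S | ∃ s ∈ S, s ∈ M.accept}

theorem DFA.mem_superword_evalFrom {A σ : Type*} (M : DFA A σ) (w : List A) (S : Set σ) (t : σ) :
    t ∈ M.superword.evalFrom S w ↔ ∃ s ∈ S, ∃ u, u.Sublist w ∧ M.evalFrom s u = t := by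
  induction w generalizing S with
  | nil => simp
  | cons a w ih =>
    rw [DFA.evalFrom_cons, ih]
    constructor
    · rintro ⟨s, hs | ⟨r, hr, rfl⟩, u, hu, rfl⟩
      · exact ⟨s, hs, u, hu.cons a, rfl⟩
      · exact ⟨r, hr, a :: u, hu.cons_cons a, rfl⟩
    · rintro ⟨s, hs, u, hu, rfl⟩
      rcases List.sublist_cons_iff.mp hu with hu | ⟨r, rfl, hr⟩
      · exact ⟨s, Or.inl hs, u, hu, rfl⟩
      · exact ⟨M.step s a, Or.inr ⟨s, hs, rfl⟩, r, hr, rfl⟩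

/-- The set of superwords of words in a regular language is regular. -/
theorem RegularLang.superwords {A : Type*} {L : Set (List A)} (h : RegularLang L) :
    RegularLang {v | ∃ u ∈ L, u.Sublist v} := by
  classical
  obtain ⟨σ, _, M, hM⟩ := h
  refine ⟨Set σ, inferInstance, M.superword, fun v => ?_⟩
  constructor
  · rintro ⟨t, ht, hacc⟩
    obtain ⟨s, rfl, u, hu, rfl⟩ := (M.mem_superword_evalFrom v _ t).mp ht
    exact ⟨u, (hM u).mp hacc, hu⟩
  · rintro ⟨u, hu, huv⟩
    exact ⟨M.eval u, (M.mem_superword_evalFrom v _ _).mpr ⟨M.start, rfl, u, huv, rfl⟩,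
      (hM u).mpr hu⟩

theorem mem_iff_even_of_alternating {A : Type*} {L : Set (List A)} {c : ℕ → List A} {m : ℕ}
    (h0 : c 0 ∈ L) (h : ∀ i < m, (c i ∈ L ↔ c (i + 1) ∉ L)) : c m ∈ L ↔ Even m := by
  induction m with
  | zero => simpa using h0
  | succ m ih =>
    have h₁ := ih fun i hi => h i (by lia)
    have h₂ := h m (by lia)
    rw [Nat.even_add_one]
    tauto

theorem LPlus_zero {A : Type*} (L : Set (List A)) : LPlus L 0 = {v | ∃ u ∈ L, u.Sublist v} := by
  ext v
  constructor
  · rintro ⟨c, h0, -, hv, -⟩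
    exact ⟨c 0, h0, hv⟩
  · rintro ⟨u, hu, huv⟩
    exact ⟨fun _ => u, hu, by simp, huv, by simp⟩

theorem LPlus_succ {A : Type*} (L : Set (List A)) (m : ℕ) :
    LPlus L (m + 1) = {v | ∃ u ∈ LPlus L m ∩ {w | w ∈ L ↔ Even (m + 1)}, u.Sublist v} := by
  ext v
  constructor
  · rintro ⟨c, h0, hc, hv, halt⟩
    exact ⟨c (m + 1), ⟨⟨c, h0, fun i hi => hc i (by lia), hc m (by lia),
      fun i hi => halt i (by lia)⟩, mem_iff_even_of_alternating h0 halt⟩, hv⟩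
  · rintro ⟨u, ⟨⟨c, h0, hc, hu, halt⟩, hmem⟩, huv⟩
    have hm := mem_iff_even_of_alternating h0 halt
    have hagree : ∀ i ≤ m, Function.update c (m + 1) u i = c i := fun i hi =>
      Function.update_of_ne (by lia) _ _
    have hlast : Function.update c (m + 1) u (m + 1) = u := Function.update_self _ _ _
    refine ⟨Function.update c (m + 1) u, ?_, fun i hi => ?_, ?_, fun i hi => ?_⟩
    · rwa [hagree 0 (by lia)]
    · rcases Nat.lt_succ_iff_lt_or_eq.mp hi with hi | rfl
      · rw [hagree i (by lia), hagree (i + 1) (by lia)]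
        exact hc i hi
      · rwa [hlast, hagree i le_rfl]
    · rwa [hlast]
    · rcases Nat.lt_succ_iff_lt_or_eq.mp hi with hi | rfl
      · rw [hagree i (by lia), hagree (i + 1) (by lia)]
        exact halt i hi
      · rw [hlast, hagree i le_rfl, hm]
        have hmem' : u ∈ L ↔ Even (i + 1) := hmem
        rw [hmem', Nat.even_add_one, not_not]

theorem RegularLang.lPlus {A : Type*} {L : Set (List A)} (hL : RegularLang L) (m : ℕ) :
    RegularLang (LPlus L m) := by
  induction m with
  | zero =>
    rw [LPlus_zero]
    exact hL.superwords
  | succ m ih =>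
    rw [LPlus_succ]
    refine (ih.inter ?_).superwords
    by_cases h : Even (m + 1)
    · simp only [h, iff_true]
      exact hL
    · simp only [h, iff_false]
      exact hL.compl

/-- If `L` is regular then so are `L⁺(m)` and `L⁻(m)` for every `m`. -/
theorem stmt6 {A : Type*} [Fintype A] (L : Set (List A)) (hL : RegularLang L) (m : ℕ) :
    RegularLang (LPlus L m) ∧ RegularLang (LMinus L m) := by
  rw [LMinus_eq_LPlus_compl]
  exact ⟨hL.lPlus m, hL.compl.lPlus m⟩
end

section
/- If L is a regular language over a finite alphabet A, then for every m ≥ 0 the languages L^+(m) and L^-(m) belong to L_{1/2}, i.e., each is a finite union of sets ⟦w⟧ = {v : w ⊑ v} for words w. -/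
/-- The class `L_{1/2}`: finite unions of sets `⟦w⟧ = {v | w ⊑ v}`. -/
def LhalfClass (A : Type*) : Set (Set (List A)) :=
  {L | ∃ W : Finset (List A), L = ⋃ w ∈ W, {v : List A | w.Sublist v}}

/-- Higman's lemma for the scattered subword order over a finite alphabet. -/
theorem List.wellQuasiOrdered_sublist (A : Type*) [Finite A] :
    WellQuasiOrdered (List.Sublist : List A → List A → Prop) := by
  have h := Set.PartiallyWellOrderedOn.partiallyWellOrderedOn_sublistForall₂ (Eq : A → A → Prop)
    (s := Set.univ) Set.finite_univ.partiallyWellOrderedOn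
  intro f
  obtain ⟨m, n, hmn, hf⟩ := h.exists_lt (f := f) (fun _ _ _ => Set.mem_univ _)
  refine ⟨m, n, hmn, ?_⟩
  simpa [List.sublistForall₂_iff, List.forall₂_eq_eq_eq] using hf

/-- A language closed under passing to superwords is generated by finitely many words. -/
theorem mem_LhalfClass_of_sublist_closed {A : Type*} [Finite A] {S : Set (List A)}
    (hS : ∀ ⦃u v : List A⦄, u ∈ S → u.Sublist v → v ∈ S) : S ∈ LhalfClass A := by
  let T : Set (List A) := {w ∈ S | ∀ u ∈ S, u.Sublist w → u = w}
  have hT : T.Finite := by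
    refine IsAntichain.finite_of_wellQuasiOrdered (r := List.Sublist) ?_
      (List.wellQuasiOrdered_sublist A)
    intro u hu v hv huv h
    exact huv (hv.2 u hu.1 h)
  have below : ∀ v ∈ S, ∃ w ∈ T, w.Sublist v := by
    intro v
    induction hn : v.length using Nat.strong_induction_on generalizing v with
    | _ n ih =>
      intro hv
      by_cases hm : v ∈ T
      · exact ⟨v, hm, List.Sublist.refl v⟩
      · obtain ⟨u, hu, huv, hne⟩ : ∃ u ∈ S, u.Sublist v ∧ u ≠ v := by
          by_contra! h
          exact hm ⟨hv, h⟩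
        have hlt : u.length < n :=
          hn ▸ lt_of_le_of_ne huv.length_le fun h => hne (huv.eq_of_length h)
        obtain ⟨w, hw, hwu⟩ := ih _ hlt u rfl hu
        exact ⟨w, hw, hwu.trans huv⟩
  refine ⟨hT.toFinset, Set.ext fun v => ?_⟩
  simp only [Set.Finite.mem_toFinset, Set.mem_iUnion, Set.mem_ofPred_eq, exists_prop]
  exact ⟨below v, fun ⟨w, hw, hwv⟩ => hS hw.1 hwv⟩

/-- If `L` is regular then `L⁺(m)` and `L⁻(m)` belong to `L_{1/2}`, i.e. each is
a finite union of sets `⟦w⟧`. -/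
theorem stmt7 {A : Type*} [Fintype A] (L : Set (List A)) (hL : RegularLang L) (m : ℕ) :
    LPlus L m ∈ LhalfClass A ∧ LMinus L m ∈ LhalfClass A := by
  exact ⟨mem_LhalfClass_of_sublist_closed fun _ _ ⟨c, h0, hc, hu, ha⟩ huv =>
      ⟨c, h0, hc, hu.trans huv, ha⟩,
    mem_LhalfClass_of_sublist_closed fun _ _ ⟨c, h0, hc, hu, ha⟩ huv =>
      ⟨c, h0, hc, hu.trans huv, ha⟩⟩
end

section
/- Let A be a finite alphabet with |A| ≥ 2. Then for every k ≥ 1, L_{1/2}(k) is a proper subclass of L_{1/2}(k+1). -/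
/-- The `k`-th level of the boolean hierarchy over a class `C`:
`C(k) = {L₁ Δ L₂ Δ ⋯ Δ L_k | L₁, …, L_k ∈ C}` (`Δ` is symmetric difference). -/
def boolLevel {X : Type*} (C : Set (Set X)) (k : ℕ) : Set (Set X) :=
  {L | ∃ Ls : List (Set X), Ls.length = k ∧ (∀ M ∈ Ls, M ∈ C) ∧
    L = Ls.foldr symmDiff ∅}

theorem LhalfClass.mem_of_sublist {A : Type*} {L : Set (List A)} (hL : L ∈ LhalfClass A)
    {u v : List A} (huv : u.Sublist v) (hu : u ∈ L) : v ∈ L := by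
  obtain ⟨W, rfl⟩ := hL
  simp only [Set.mem_iUnion, Set.mem_ofPred_eq, exists_prop] at hu ⊢
  obtain ⟨w, hw, hwu⟩ := hu
  exact ⟨w, hw, hwu.trans huv⟩

theorem empty_mem_LhalfClass (A : Type*) : (∅ : Set (List A)) ∈ LhalfClass A :=
  ⟨∅, by simp⟩

theorem upward_mem_LhalfClass {A : Type*} (w : List A) :
    {v : List A | w.Sublist v} ∈ LhalfClass A :=
  ⟨{w}, by simp⟩

open Classical in
/-- The positions `n < N` at which membership in `L` changes from `aⁿ` to `aⁿ⁺¹`. -/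
noncomputable def membershipChanges {A : Type*} (a : A) (N : ℕ) (L : Set (List A)) : Finset ℕ :=
  {n ∈ Finset.range N | ¬ (List.replicate n a ∈ L ↔ List.replicate (n + 1) a ∈ L)}

theorem mem_membershipChanges {A : Type*} {a : A} {N n : ℕ} {L : Set (List A)} :
    n ∈ membershipChanges a N L ↔
      n < N ∧ ¬ (List.replicate n a ∈ L ↔ List.replicate (n + 1) a ∈ L) := by
  simp [membershipChanges]

theorem membershipChanges_symmDiff_subset {A : Type*} (a : A) (N : ℕ) (L M : Set (List A)) :
    membershipChanges a N (symmDiff L M) ⊆ membershipChanges a N L ∪ membershipChanges a N M := by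
  intro n
  simp only [mem_membershipChanges, Finset.mem_union, Set.mem_symmDiff]
  tauto

theorem card_membershipChanges_le_one {A : Type*} (a : A) (N : ℕ) {L : Set (List A)}
    (hL : L ∈ LhalfClass A) : (membershipChanges a N L).card ≤ 1 := by
  have up {m n : ℕ} (hmn : m ≤ n) (hm : List.replicate m a ∈ L) : List.replicate n a ∈ L :=
    LhalfClass.mem_of_sublist hL ((List.replicate_sublist_replicate a).2 hmn) hm
  have change {n : ℕ} (hn : n ∈ membershipChanges a N L) :
      List.replicate n a ∉ L ∧ List.replicate (n + 1) a ∈ L := by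
    have h := (mem_membershipChanges.1 hn).2
    have := up (Nat.le_succ n)
    tauto
  refine Finset.card_le_one.2 fun m hm n hn => ?_
  rcases lt_trichotomy m n with h | h | h
  · exact absurd (up h (change hm).2) (change hn).1
  · exact h
  · exact absurd (up h (change hn).2) (change hm).1

theorem card_membershipChanges_foldr_le {A : Type*} (a : A) (N : ℕ) (Ls : List (Set (List A)))
    (hLs : ∀ M ∈ Ls, M ∈ LhalfClass A) :
    (membershipChanges a N (Ls.foldr symmDiff ∅)).card ≤ Ls.length := by
  induction Ls with
  | nil => simp [membershipChanges]
  | cons L Ls ih =>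
    rw [List.foldr_cons, List.length_cons]
    have h₁ := Finset.card_le_card
      (membershipChanges_symmDiff_subset a N L (Ls.foldr symmDiff ∅))
    have h₂ := Finset.card_union_le (membershipChanges a N L)
      (membershipChanges a N (Ls.foldr symmDiff ∅))
    have h₃ := card_membershipChanges_le_one a N (hLs L (by simp))
    have h₄ := ih fun M hM => hLs M (List.mem_cons_of_mem _ hM)
    omega

theorem replicate_mem_foldr_symmDiff_iff {A : Type*} (a : A) (n : ℕ) (l : List ℕ) :
    List.replicate n a ∈ (l.map fun i =>
      {v : List A | (List.replicate (i + 1) a).Sublist v}).foldr symmDiff ∅ ↔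
      Odd (l.countP (· < n)) := by
  induction l with
  | nil => simp
  | cons i l ih =>
    rw [List.map_cons, List.foldr_cons, Set.mem_symmDiff, ih, List.countP_cons]
    simp only [Set.mem_ofPred_eq, List.replicate_sublist_replicate, Nat.succ_le_iff]
    by_cases h : i < n <;> simp [h, Nat.odd_add_one]

theorem List.countP_lt_range {m n : ℕ} (h : n ≤ m) : (List.range m).countP (· < n) = n := by
  induction m, h using Nat.le_induction with
  | base =>
    conv_rhs => rw [← List.length_range (n := n)]
    rw [List.countP_eq_length]
    simp
  | succ m hm ih => simp [List.range_succ, ih, hm]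

theorem boolLevel_subset_succ {X : Type*} {C : Set (Set X)} (hC : ∅ ∈ C) (k : ℕ) :
    boolLevel C k ⊆ boolLevel C (k + 1) := by
  rintro L ⟨Ls, hk, hLs, rfl⟩
  refine ⟨∅ :: Ls, by simp [hk], by simpa using ⟨hC, hLs⟩, ?_⟩
  rw [List.foldr_cons, ← Set.bot_eq_empty, bot_symmDiff]

/-- For `|A| ≥ 2` and `k ≥ 1`, `L_{1/2}(k)` is a proper subclass of `L_{1/2}(k+1)`. -/
theorem stmt12 {A : Type*} [Fintype A] (hA : 2 ≤ Fintype.card A) (k : ℕ) (hk : 1 ≤ k) :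
    boolLevel (LhalfClass A) k ⊂ boolLevel (LhalfClass A) (k + 1) := by
  obtain ⟨a⟩ : Nonempty A := Fintype.card_pos_iff.1 (by omega)
  refine ⟨boolLevel_subset_succ (empty_mem_LhalfClass A) k, fun hsub => ?_⟩
  obtain ⟨Ls, hlen, hLs, heq⟩ := hsub ⟨(List.range (k + 1)).map fun i =>
    {v : List A | (List.replicate (i + 1) a).Sublist v}, by simp, by
      intro M hM
      obtain ⟨i, -, rfl⟩ := List.mem_map.1 hM
      exact upward_mem_LhalfClass _, rfl⟩
  have hle := card_membershipChanges_foldr_le a (k + 1) Ls hLs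
  rw [← heq, hlen] at hle
  refine absurd (hle.trans' (Finset.card_le_card (s := Finset.range (k + 1)) fun n hn => ?_))
    (by simp)
  have hn' : n < k + 1 := Finset.mem_range.1 hn
  rw [mem_membershipChanges, replicate_mem_foldr_symmDiff_iff, replicate_mem_foldr_symmDiff_iff,
    List.countP_lt_range hn'.le, List.countP_lt_range hn', Nat.odd_add_one]
  tauto
end

section
/- Let A be a finite alphabet, a ∈ A, and for a word w let |w|_a denote the number of occurrences of a in w. For k ≥ 1 define M_{2k−1} = {w : |w|_a is odd or |w|_a > 2k−1} and M_{2k} = {w : |w|_a is odd and |w|_a ≤ 2k}. Then for every k ≥ 1: m^-(M_k) = k and m^+(M_k) = k−1; in particular M_k ∈ L_{1/2}(k) but M_k ∉ co-L_{1/2}(k). -/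
/-- `m⁺(L) = sup {m | L⁺(m) ≠ ∅}`, taken in `ℕ∞ = ℕ ∪ {∞}`. -/
noncomputable def mPlus {A : Type*} (L : Set (List A)) : ℕ∞ :=
  ⨆ m ∈ {m : ℕ | (LPlus L m).Nonempty}, (m : ℕ∞)

/-- `m⁻(L) = sup {m | L⁻(m) ≠ ∅}`, taken in `ℕ∞ = ℕ ∪ {∞}`. -/
noncomputable def mMinus {A : Type*} (L : Set (List A)) : ℕ∞ :=
  ⨆ m ∈ {m : ℕ | (LMinus L m).Nonempty}, (m : ℕ∞)

/-- The witness languages: for odd `n = 2k−1`,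
`M_n = {w | |w|_a odd or |w|_a > n}`; for even `n = 2k`,
`M_n = {w | |w|_a odd and |w|_a ≤ n}`. -/
def Mwitness {A : Type*} [DecidableEq A] (a : A) (n : ℕ) : Set (List A) :=
  if n % 2 = 1 then {w | Odd (w.count a) ∨ n < w.count a}
  else {w | Odd (w.count a) ∧ w.count a ≤ n}

theorem mem_Mwitness_iff {A : Type*} [DecidableEq A] (a : A) (k : ℕ) (w : List A) :
    w ∈ Mwitness a k ↔ Odd (min (w.count a) k) := by
  unfold Mwitness
  split_ifs with h <;> simp only [Set.mem_ofPred_eq, Nat.odd_iff] <;> omega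

/-- Along an alternating chain, a monotone rank whose parity decides membership
grows by at least one at every step. -/
theorem rank_add_le_of_alternating {A : Type*} {L : Set (List A)} {f : List A → ℕ}
    (hf : ∀ u v : List A, u.Sublist v → f u ≤ f v) (hL : ∀ w, w ∈ L ↔ Odd (f w))
    {m : ℕ} {c : ℕ → List A} (hc : ∀ i < m, (c i).Sublist (c (i + 1)))
    (halt : ∀ i < m, (c i ∈ L ↔ c (i + 1) ∉ L)) :
    f (c 0) + m ≤ f (c m) := by
  induction m with
  | zero => simp
  | succ n ih =>
    have h := ih (fun i hi => hc i (by omega)) (fun i hi => halt i (by omega))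
    have hle := hf _ _ (hc n (by omega))
    have ha := halt n (by omega)
    rw [hL, hL, Nat.odd_iff, Nat.odd_iff] at ha
    omega

theorem exists_rank_of_mem_boolLevel {A : Type*} {L : Set (List A)} {k : ℕ}
    (h : L ∈ boolLevel (LhalfClass A) k) :
    ∃ f : List A → ℕ, (∀ u v : List A, u.Sublist v → f u ≤ f v) ∧ (∀ w, f w ≤ k) ∧
      ∀ w, w ∈ L ↔ Odd (f w) := by
  classical
  obtain ⟨Ls, rfl, hC, rfl⟩ := h
  induction Ls with
  | nil => exact ⟨fun _ => 0, by simp, by simp, by simp⟩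
  | cons M Ls ih =>
    obtain ⟨f, hmono, hle, hodd⟩ := ih fun N hN => hC N (List.mem_cons_of_mem _ hN)
    have hM : ∀ u v : List A, u.Sublist v → u ∈ M → v ∈ M := by
      obtain ⟨W, rfl⟩ := hC M List.mem_cons_self
      intro u v huv hu
      simp only [Set.mem_iUnion, Set.mem_ofPred_eq] at hu ⊢
      obtain ⟨w, hw, hwu⟩ := hu
      exact ⟨w, hw, hwu.trans huv⟩
    refine ⟨fun w => f w + if w ∈ M then 1 else 0, ?_, ?_, ?_⟩
    · intro u v huv
      have h1 := hmono u v huv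
      have h2 := hM u v huv
      dsimp only
      split_ifs <;> first | omega | tauto
    · intro w
      have := hle w
      rw [List.length_cons]
      dsimp only
      split_ifs <;> omega
    · intro w
      rw [List.foldr_cons, Set.mem_symmDiff, hodd]
      by_cases hw : w ∈ M <;> simp [hw, Nat.odd_add_one]

theorem Mwitness_mem_boolLevel {A : Type*} [DecidableEq A] (a : A) (k : ℕ) :
    Mwitness a k ∈ boolLevel (LhalfClass A) k := by
  induction k with
  | zero =>
    refine ⟨[], rfl, by simp, ?_⟩
    ext w
    simp [mem_Mwitness_iff]
  | succ k ih =>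
    obtain ⟨Ls, hlen, hC, heq⟩ := ih
    refine ⟨{w | (List.replicate (k + 1) a).Sublist w} :: Ls, by simp [hlen], ?_, ?_⟩
    · intro M hM
      rcases List.mem_cons.mp hM with rfl | hM
      · exact ⟨{List.replicate (k + 1) a}, by simp⟩
      · exact hC M hM
    · rw [List.foldr_cons, ← heq]
      ext w
      simp only [Set.mem_symmDiff, mem_Mwitness_iff, Set.mem_ofPred_eq,
        List.replicate_sublist_iff, Nat.odd_iff]
      omega

theorem replicate_alternating_Mwitness {A : Type*} [DecidableEq A] (a : A) (k i : ℕ) (hi : i < k) :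
    List.replicate i a ∈ Mwitness a k ↔ List.replicate (i + 1) a ∉ Mwitness a k := by
  simp only [mem_Mwitness_iff, List.count_replicate_self, Nat.odd_iff]
  omega

theorem iSup_mem_setOf_eq {P : ℕ → Prop} {n : ℕ} (hn : P n) (hle : ∀ m, P m → m ≤ n) :
    ⨆ m ∈ {m : ℕ | P m}, (m : ℕ∞) = n :=
  le_antisymm (iSup₂_le fun m hm => Nat.cast_le.mpr (hle m hm))
    (le_iSup₂_of_le (f := fun (m : ℕ) (_ : m ∈ {m : ℕ | P m}) => (m : ℕ∞)) n hn le_rfl)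

/-- For every `k ≥ 1`: `m⁻(M_k) = k`, `m⁺(M_k) = k − 1`, and consequently
`M_k ∈ L_{1/2}(k)` but `M_k ∉ co-L_{1/2}(k)`. -/
theorem stmt13 {A : Type*} [Fintype A] [DecidableEq A] (a : A) (k : ℕ) (hk : 1 ≤ k) :
    mMinus (Mwitness a k) = (k : ℕ∞) ∧
    mPlus (Mwitness a k) = ((k - 1 : ℕ) : ℕ∞) ∧
    Mwitness a k ∈ boolLevel (LhalfClass A) k ∧
    (Mwitness a k)ᶜ ∉ boolLevel (LhalfClass A) k := by
  have hmono : ∀ u v : List A, u.Sublist v → min (u.count a) k ≤ min (v.count a) k :=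
    fun u v huv => min_le_min_right k (huv.count_le a)
  have hsub : ∀ i, (List.replicate i a).Sublist (List.replicate (i + 1) a) :=
    fun i => (List.replicate_sublist_replicate a).mpr (Nat.le_succ i)
  refine ⟨iSup_mem_setOf_eq ?_ ?_, iSup_mem_setOf_eq ?_ ?_, Mwitness_mem_boolLevel a k, ?_⟩
  · exact ⟨_, fun i => List.replicate i a, by simp [mem_Mwitness_iff], fun i _ => hsub i,
      List.Sublist.refl _, replicate_alternating_Mwitness a k⟩
  · rintro m ⟨v, c, -, hc, -, halt⟩
    have := rank_add_le_of_alternating hmono (mem_Mwitness_iff a k) hc halt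
    omega
  · refine ⟨_, fun i => List.replicate (i + 1) a, ?_, fun i _ => hsub (i + 1),
      List.Sublist.refl _, fun i hi => replicate_alternating_Mwitness a k (i + 1) (by omega)⟩
    simp [mem_Mwitness_iff, hk]
  · rintro m ⟨v, c, h0, hc, -, halt⟩
    have := rank_add_le_of_alternating hmono (mem_Mwitness_iff a k) hc halt
    rw [mem_Mwitness_iff, Nat.odd_iff] at h0
    omega
  · intro h
    obtain ⟨f, hf, hle, hodd⟩ := exists_rank_of_mem_boolLevel h
    have hrank := rank_add_le_of_alternating (m := k) (c := fun i => List.replicate i a) hf hodd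
      (fun i _ => hsub i) fun i hi => by
        simpa only [Set.mem_compl_iff] using not_congr (replicate_alternating_Mwitness a k i hi)
    have h0 : Odd (f (List.replicate 0 a)) := (hodd _).mp (by simp [mem_Mwitness_iff])
    have := hle (List.replicate k a)
    have := h0.pos
    omega
end

section
/- Let A be a finite alphabet with |A| letters and let F be a deterministic finite automaton over A with |F| states, accepting the language L(F). Then m^+(L(F)) is finite if and only if m^+(L(F)) ≤ 2^{|F|·|A|²}. Equivalently: if L(F)^+(2^{|F|·|A|²} + 1) ≠ ∅, then L(F)^+(m) ≠ ∅ for every m ≥ 0. -/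
/-- The language accepted by a DFA. -/
def LangOf {A σ : Type*} (M : DFA A σ) : Set (List A) :=
  {w | M.eval w ∈ M.accept}

section Chains

variable {A : Type*} {L : Set (List A)}

theorem LPlus_nonempty_of_alternating (c : ℕ → List A)
    (hc : ∀ i, (c i).Sublist (c (i + 1))) (halt : ∀ i, c i ∈ L ↔ c (i + 1) ∉ L) (m : ℕ) :
    (LPlus L m).Nonempty := by
  by_cases h0 : c 0 ∈ L
  · exact ⟨c m, c, h0, fun i _ => hc i, List.Sublist.refl _, fun i _ => halt i⟩
  · refine ⟨c (m + 1), fun i => c (i + 1), ?_, fun i _ => hc _, List.Sublist.refl _,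
      fun i _ => halt _⟩
    have := halt 0
    simp only [zero_add] at this ⊢
    tauto

theorem LPlus_nonempty_antitone {m n : ℕ} (hmn : m ≤ n) (h : (LPlus L n).Nonempty) :
    (LPlus L m).Nonempty := by
  obtain ⟨_, c, h0, hc, _, halt⟩ := h
  exact ⟨c m, c, h0, fun i hi => hc i (hi.trans_le hmn), List.Sublist.refl _,
    fun i hi => halt i (hi.trans_le hmn)⟩

theorem mPlus_eq_top (h : ∀ m, (LPlus L m).Nonempty) : mPlus L = ⊤ := by
  rw [ENat.eq_top_iff_forall_ge]
  intro m
  exact le_iSup₂ (f := fun (m : ℕ) (_ : m ∈ {m : ℕ | (LPlus L m).Nonempty}) => (m : ℕ∞)) m (h m)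

theorem mPlus_le_of_LPlus_eq_empty {n : ℕ} (h : ¬ (LPlus L (n + 1)).Nonempty) :
    mPlus L ≤ (n : ℕ∞) := by
  refine iSup₂_le fun m hm => ?_
  by_contra! hlt
  have hlt' : n < m := by exact_mod_cast hlt
  exact h (LPlus_nonempty_antitone hlt' hm)

end Chains

section SubwordEquivalence

variable {A : Type*}

/-- Two words are `k`-subword equivalent when they have the same scattered subwords of length at
most `k`. -/
def SubwordEquiv (k : ℕ) (u v : List A) : Prop :=
  ∀ w : List A, w.length ≤ k → (w.Sublist u ↔ w.Sublist v)

namespace SubwordEquiv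

variable {k : ℕ} {u v w : List A}

theorem symm (h : SubwordEquiv k u v) : SubwordEquiv k v u := fun x hx => (h x hx).symm

theorem trans (h : SubwordEquiv k u v) (h' : SubwordEquiv k v w) : SubwordEquiv k u w :=
  fun x hx => (h x hx).trans (h' x hx)

theorem cons (a : A) (h : SubwordEquiv k u v) : SubwordEquiv k (a :: u) (a :: v) := by
  intro w hw
  rw [List.sublist_cons_iff, List.sublist_cons_iff, h w hw]
  refine or_congr_right (exists_congr fun r => and_congr_right ?_)
  rintro rfl
  exact h r ((Nat.le_succ _).trans hw)

theorem mem_iff (h : SubwordEquiv (k + 1) u v) (a : A) : a ∈ u ↔ a ∈ v := by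
  simpa [List.singleton_sublist] using h [a] (by simp)

theorem of_sublist (huv : u.Sublist v) (h : ∀ x : List A, x.length ≤ k → x.Sublist v → x.Sublist u) :
    SubwordEquiv k u v := fun x hx => ⟨fun h' => h'.trans huv, h x hx⟩

/-- Prepending letters that fix the class of `u` does not leave the class of `u`. -/
theorem append_left {x : List A} (h : ∀ a ∈ x, SubwordEquiv k (a :: u) u) :
    SubwordEquiv k (x ++ u) u := by
  induction x with
  | nil => exact fun _ _ => Iff.rfl
  | cons a x ih =>
    exact ((ih fun b hb => h b (List.mem_cons_of_mem _ hb)).cons a).trans (h a List.mem_cons_self)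

end SubwordEquiv

theorem List.forall_or_exists_append_cons (p : A → Prop) (u : List A) :
    (∀ x ∈ u, p x) ∨ ∃ u₁ a u₂, u = u₁ ++ a :: u₂ ∧ (∀ x ∈ u₁, p x) ∧ ¬ p a := by
  induction u with
  | nil => simp
  | cons b u ih =>
    by_cases hb : p b
    · rcases ih with h | ⟨u₁, a, u₂, rfl, h₁, ha⟩
      · left
        simpa [hb] using h
      · right
        refine ⟨b :: u₁, a, u₂, rfl, ?_, ha⟩
        simpa [hb] using h₁
    · exact Or.inr ⟨[], b, u, rfl, by simp, hb⟩

theorem List.cons_sublist_append_cons {a : A} {u₁ : List A} (ha : a ∉ u₁) (w u₂ : List A) :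
    (a :: w).Sublist (u₁ ++ a :: u₂) ↔ w.Sublist u₂ := by
  induction u₁ with
  | nil => simp
  | cons b u₁ ih =>
    simp only [List.mem_cons, not_or] at ha
    rw [List.cons_append, List.sublist_cons_iff, ih ha.2]
    constructor
    · rintro (h | ⟨r, h, -⟩)
      · exact h
      · exact absurd (List.cons.inj h).1 ha.1
    · exact Or.inl

theorem finite_length_lt_ncard_le (A : Type*) [Fintype A] (n : ℕ) :
    {w : List A | w.length < n}.ncard ≤ (Fintype.card A + 1) ^ n := by
  classical
  have hinj : Set.InjOn (fun (w : List A) (i : Fin n) => w[(i : ℕ)]?)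
      {w : List A | w.length < n} := by
    intro u hu v hv huv
    refine List.ext_getElem? fun i => ?_
    by_cases hi : i < n
    · exact congrFun huv ⟨i, hi⟩
    · simp only [Set.mem_ofPred_eq] at hu hv
      rw [List.getElem?_eq_none (by omega), List.getElem?_eq_none (by omega)]
  have := Set.ncard_le_ncard_of_injOn _ (fun _ _ => Set.mem_univ _) hinj Set.finite_univ
  simpa [Set.ncard_univ, Nat.card_eq_fintype_card] using this

theorem exists_subwordEquiv_of_chain [Fintype A] {k m : ℕ} (c : ℕ → List A)
    (hc : ∀ i < m, (c i).Sublist (c (i + 1))) (hm : (Fintype.card A + 1) ^ (k + 1) < m) :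
    ∃ i < m, SubwordEquiv k (c i) (c (i + 1)) := by
  by_contra! hne
  have hfin : {w : List A | w.length < k + 1}.Finite := List.finite_length_lt A (k + 1)
  let S : ℕ → Set (List A) := fun i => {w | w.length < k + 1 ∧ w.Sublist (c i)}
  have hS : ∀ i, S i ⊆ {w : List A | w.length < k + 1} := fun i w hw => hw.1
  have key : ∀ i ≤ m, i ≤ (S i).ncard := by
    intro i
    induction i with
    | zero => simp
    | succ i ih =>
      intro hi
      refine Nat.succ_le_of_lt ((ih (by omega)).trans_lt ?_)
      refine Set.ncard_lt_ncard ?_ (hfin.subset (hS _))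
      refine ⟨fun w hw => ⟨hw.1, hw.2.trans (hc i hi)⟩, fun hsub => hne i hi ?_⟩
      exact SubwordEquiv.of_sublist (hc i hi)
        fun w hw hw' => (hsub ⟨Nat.lt_succ_of_le hw, hw'⟩).2
  have h1 := key m le_rfl
  have h2 := Set.ncard_le_ncard (hS m) hfin
  have h3 := finite_length_lt_ncard_le A (k + 1)
  omega

end SubwordEquivalence

namespace DFA

variable {A ρ : Type*} (N : DFA A ρ)

/-- The set of states reachable from `q`. -/
def reach (q : ρ) : Set ρ := Set.range (N.evalFrom q)

theorem mem_reach_self (q : ρ) : q ∈ N.reach q := ⟨[], rfl⟩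

theorem evalFrom_eq_self {q : ρ} {u : List A} (h : ∀ a ∈ u, N.step q a = q) :
    N.evalFrom q u = q := by
  induction u with
  | nil => rfl
  | cons a u ih =>
    rw [evalFrom_cons, h a List.mem_cons_self]
    exact ih fun b hb => h b (List.mem_cons_of_mem _ hb)

/-- Every cycle of the automaton is a loop. -/
def Acyclic : Prop :=
  ∀ (q : ρ) (x y : List A), N.evalFrom q (x ++ y) = q → N.evalFrom q x = q

/-- Two words leading from the same state to states that are fixed by all letters of both words
lead to the same state. -/
def Confluent : Prop :=
  ∀ (q : ρ) (x y : List A),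
    (∀ a ∈ x ++ y, N.step (N.evalFrom q x) a = N.evalFrom q x) →
    (∀ a ∈ x ++ y, N.step (N.evalFrom q y) a = N.evalFrom q y) →
    N.evalFrom q x = N.evalFrom q y

/-- Distinct states are separated by some word, and all states are reachable. -/
def Reduced : Prop :=
  (∀ q, ∃ x, N.eval x = q) ∧
    ∀ s t, s ≠ t → ∃ z, ¬ (N.evalFrom s z ∈ N.accept ↔ N.evalFrom t z ∈ N.accept)

variable {N}

theorem Acyclic.reach_step_ncard_lt [Finite ρ] (hN : N.Acyclic) {q : ρ} {a : A}
    (ha : N.step q a ≠ q) : (N.reach (N.step q a)).ncard < (N.reach q).ncard := by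
  refine Set.ncard_lt_ncard ⟨?_, fun h => ?_⟩ (Set.toFinite _)
  · rintro _ ⟨x, rfl⟩
    exact ⟨a :: x, rfl⟩
  · obtain ⟨y, hy⟩ := h (N.mem_reach_self q)
    exact ha (hN q [a] y hy)

/-- From every state one can read a word over `B` leading to a state fixed by all letters
of `B`. -/
theorem Acyclic.exists_fixed [Finite ρ] (hN : N.Acyclic) (B : Set A) (q : ρ) :
    ∃ w : List A, (∀ a ∈ w, a ∈ B) ∧ ∀ a ∈ B, N.step (N.evalFrom q w) a = N.evalFrom q w := by
  induction h : (N.reach q).ncard using Nat.strong_induction_on generalizing q with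
  | _ n ih =>
    subst h
    by_cases hq : ∀ a ∈ B, N.step q a = q
    · exact ⟨[], by simp, hq⟩
    · push Not at hq
      obtain ⟨a, haB, ha⟩ := hq
      obtain ⟨w, hwB, hw⟩ := ih _ (hN.reach_step_ncard_lt ha) _ rfl
      refine ⟨a :: w, ?_, hw⟩
      simpa [haB] using hwB

theorem Confluent.exists_join [Finite ρ] (hN : N.Confluent) (hN' : N.Acyclic) (q : ρ) (a b : A) :
    ∃ w w' : List A, (∀ c ∈ w, c = a ∨ c = b) ∧ (∀ c ∈ w', c = a ∨ c = b) ∧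
      N.evalFrom q (a :: w) = N.evalFrom q (b :: w') := by
  obtain ⟨w, hw, hfix⟩ := hN'.exists_fixed {c | c = a ∨ c = b} (N.step q a)
  obtain ⟨w', hw', hfix'⟩ := hN'.exists_fixed {c | c = a ∨ c = b} (N.step q b)
  have hmem : ∀ c ∈ (a :: w) ++ (b :: w'), c = a ∨ c = b := by
    intro c hc
    simp only [List.cons_append, List.mem_cons, List.mem_append] at hc
    rcases hc with rfl | hc | rfl | hc
    · exact Or.inl rfl
    · exact hw c hc
    · exact Or.inr rfl
    · exact hw' c hc
  exact ⟨w, w', hw, hw', hN q _ _ (fun c hc => hfix c (hmem c hc))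
    fun c hc => hfix' c (hmem c hc)⟩

/-- In an acyclic confluent automaton, words that are `n`-subword equivalent act in the same way on
a state from which at most `n + 1` states are reachable. -/
theorem Acyclic.evalFrom_eq [Finite ρ] (hN : N.Acyclic) (hN' : N.Confluent) (n : ℕ) (q : ρ)
    (hq : (N.reach q).ncard ≤ n + 1) {u v : List A} (huv : SubwordEquiv n u v) :
    N.evalFrom q u = N.evalFrom q v := by
  classical
  induction n generalizing q u v with
  | zero => exact (Set.ncard_le_one (Set.toFinite _)).1 hq _ ⟨u, rfl⟩ _ ⟨v, rfl⟩
  | succ n ih =>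
    have hstep : ∀ a, N.step q a ≠ q → (N.reach (N.step q a)).ncard ≤ n + 1 := fun a ha => by
      have := hN.reach_step_ncard_lt ha
      omega
    rcases List.forall_or_exists_append_cons (fun a => N.step q a = q) u with
      hu | ⟨u₁, a, u₂, rfl, hu₁, ha⟩
    · rw [N.evalFrom_eq_self hu, N.evalFrom_eq_self fun a hav => hu a ((huv.mem_iff a).2 hav)]
    rcases List.forall_or_exists_append_cons (fun a => N.step q a = q) v with
      hv | ⟨v₁, b, v₂, rfl, hv₁, hb⟩
    · exact absurd (hv a ((huv.mem_iff a).1 (by simp))) ha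
    have hau₁ : a ∉ u₁ := fun h => ha (hu₁ a h)
    have hbv₁ : b ∉ v₁ := fun h => hb (hv₁ b h)
    have hav₁ : a ∉ v₁ := fun h => ha (hv₁ a h)
    have hbu₁ : b ∉ u₁ := fun h => hb (hu₁ b h)
    rw [N.evalFrom_of_append, N.evalFrom_of_append, N.evalFrom_eq_self hu₁,
      N.evalFrom_eq_self hv₁, evalFrom_cons, evalFrom_cons]
    by_cases hab : a = b
    · subst hab
      refine ih _ (hstep a ha) fun w hw => ?_
      have := huv (a :: w) (by simpa using hw)
      rwa [List.cons_sublist_append_cons hau₁, List.cons_sublist_append_cons hav₁] at this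
    obtain ⟨u₃, u₄, rfl, hbu₃⟩ : ∃ u₃ u₄, u₂ = u₃ ++ b :: u₄ ∧ b ∉ u₃ := by
      have hmem : b ∈ u₁ ++ a :: u₂ := (huv.mem_iff b).2 (by simp)
      have : b ∈ u₂ := by simpa [hbu₁, Ne.symm hab] using hmem
      obtain ⟨s, t, h₁, h₂⟩ := List.eq_append_cons_of_mem this
      exact ⟨s, t, h₁, h₂⟩
    obtain ⟨v₃, v₄, rfl, hav₃⟩ : ∃ v₃ v₄, v₂ = v₃ ++ a :: v₄ ∧ a ∉ v₃ := by
      have hmem : a ∈ v₁ ++ b :: v₂ := (huv.mem_iff a).1 (by simp)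
      have : a ∈ v₂ := by simpa [hav₁, hab] using hmem
      obtain ⟨s, t, h₁, h₂⟩ := List.eq_append_cons_of_mem this
      exact ⟨s, t, h₁, h₂⟩
    have huv₄ : SubwordEquiv n (u₃ ++ b :: u₄) v₄ := fun w hw => by
      have := huv (a :: w) (by simpa using hw)
      rwa [List.cons_sublist_append_cons hau₁, ← List.cons_append, ← List.append_assoc,
        List.cons_sublist_append_cons (by simp [hav₁, hav₃, hab])] at this
    have hvu₄ : SubwordEquiv n (v₃ ++ a :: v₄) u₄ := fun w hw => by
      have := (huv (b :: w) (by simpa using hw)).symm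
      rwa [List.cons_sublist_append_cons hbv₁, ← List.cons_append, ← List.append_assoc,
        List.cons_sublist_append_cons (by simp [hbu₁, hbu₃, Ne.symm hab])] at this
    have hav₄ : (a :: v₄).Sublist (v₃ ++ a :: v₄) := List.sublist_append_right _ _
    have hbu₄ : (b :: u₄).Sublist (u₃ ++ b :: u₄) := List.sublist_append_right _ _
    have hvu : SubwordEquiv n (v₃ ++ a :: v₄) (u₃ ++ b :: u₄) := fun w hw =>
      ⟨fun h => (((hvu₄ w hw).1 h).cons b).trans hbu₄,
        fun h => (((huv₄ w hw).1 h).cons a).trans hav₄⟩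
    have hav : SubwordEquiv n (a :: v₄) v₄ := fun w hw =>
      ⟨fun h => (huv₄ w hw).1 ((hvu w hw).1 (h.trans hav₄)), fun h => h.cons a⟩
    have hbu : SubwordEquiv n (b :: u₄) u₄ := fun w hw =>
      ⟨fun h => (hvu₄ w hw).1 ((hvu w hw).2 (h.trans hbu₄)), fun h => h.cons b⟩
    have hvu' : SubwordEquiv n v₄ u₄ := (huv₄.symm.trans hvu.symm).trans hvu₄
    have hbv : SubwordEquiv n (b :: v₄) v₄ := ((hvu'.cons b).trans hbu).trans hvu'.symm
    have hpad : ∀ w : List A, (∀ c ∈ w, c = a ∨ c = b) → SubwordEquiv n (w ++ v₄) v₄ :=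
      fun w hw => SubwordEquiv.append_left fun c hc => by
        rcases hw c hc with rfl | rfl
        · exact hav
        · exact hbv
    obtain ⟨w, w', hw, hw', hjoin⟩ := hN'.exists_join hN q a b
    calc N.evalFrom (N.step q a) (u₃ ++ b :: u₄)
        = N.evalFrom (N.step q a) (w ++ v₄) := ih _ (hstep a ha) (huv₄.trans (hpad w hw).symm)
      _ = N.evalFrom (N.step q b) (w' ++ v₄) := by
          rw [N.evalFrom_of_append, N.evalFrom_of_append, ← evalFrom_cons, ← evalFrom_cons, hjoin]
      _ = N.evalFrom (N.step q b) (v₃ ++ a :: v₄) :=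
          ih _ (hstep b hb) ((hpad w' hw').trans (huv₄.symm.trans hvu.symm))

theorem Reduced.LPlus_nonempty (hN : N.Reduced) {q s t : ρ} (hst : s ≠ t) (w : ℕ → List A)
    (hw : ∀ i, (w i).Sublist (w (i + 1)))
    (heval : ∀ i, N.evalFrom q (w i) = if Even i then s else t) (m : ℕ) :
    (LPlus (LangOf N) m).Nonempty := by
  obtain ⟨p, rfl⟩ := hN.1 q
  obtain ⟨z, hz⟩ := hN.2 s t hst
  have hmem : ∀ i, p ++ w i ++ z ∈ LangOf N ↔
      N.evalFrom (if Even i then s else t) z ∈ N.accept := fun i => by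
    rw [← heval i]
    change N.evalFrom N.start (p ++ w i ++ z) ∈ N.accept ↔ _
    rw [N.evalFrom_of_append, N.evalFrom_of_append]
    rfl
  refine LPlus_nonempty_of_alternating (fun i => p ++ w i ++ z)
    (fun i => ((hw i).append_left p).append_right z) (fun i => ?_) m
  rw [hmem, hmem]
  by_cases hi : Even i
  · simp only [hi, Nat.even_add_one, not_true_eq_false, if_true, if_false]
    tauto
  · simp only [hi, Nat.even_add_one, not_false_eq_true, if_true, if_false]
    tauto

theorem Reduced.acyclic (hN : N.Reduced) (h : ¬ ∀ m, (LPlus (LangOf N) m).Nonempty) :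
    N.Acyclic := by
  intro q x y hxy
  by_contra hne
  refine h (hN.LPlus_nonempty (q := q) (Ne.symm hne)
    (fun i => Nat.rec [] (fun i u => u ++ if Even i then x else y) i)
    (fun i => List.sublist_append_left _ _) fun i => ?_)
  induction i with
  | zero => simp
  | succ i ih =>
    rw [N.evalFrom_of_append, ih]
    by_cases hi : Even i
    · simp [hi, Nat.even_add_one]
    · simpa [hi, Nat.even_add_one, N.evalFrom_of_append] using hxy

theorem Reduced.confluent (hN : N.Reduced) (h : ¬ ∀ m, (LPlus (LangOf N) m).Nonempty) :
    N.Confluent := by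
  intro q x y hx hy
  by_contra hne
  let w : ℕ → List A := fun i => Nat.rec x (fun i u => (if Even i then y else x) ++ u) i
  have hw : ∀ i, ∀ a ∈ w i, a ∈ x ++ y := by
    intro i
    induction i with
    | zero => exact fun a ha => List.mem_append_left _ ha
    | succ i ih =>
      intro a ha
      rcases List.mem_append.1 ha with ha | ha
      · split_ifs at ha
        · exact List.mem_append_right _ ha
        · exact List.mem_append_left _ ha
      · exact ih a ha
  refine h (hN.LPlus_nonempty (q := q) hne w (fun i => List.sublist_append_right _ _) fun i => ?_)
  cases i with
  | zero => simp [w]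
  | succ i =>
    change N.evalFrom q ((if Even i then y else x) ++ w i) = _
    rw [N.evalFrom_of_append]
    by_cases hi : Even i
    · simpa [hi, Nat.even_add_one] using N.evalFrom_eq_self fun a ha => hy a (hw i a ha)
    · simpa [hi, Nat.even_add_one] using N.evalFrom_eq_self fun a ha => hx a (hw i a ha)

theorem reduced_toDFA (L : Language A) : L.toDFA.Reduced := by
  have heval : ∀ (s : Set.range L.leftQuotient) (x : List A),
      (L.toDFA.evalFrom s x).val = s.val.leftQuotient x := by
    intro s x
    induction x using List.reverseRecOn with
    | nil => simp
    | append_singleton x a ih =>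
      rw [evalFrom_append_singleton, Language.step_toDFA, ih, Language.leftQuotient_append]
  refine ⟨?_, fun s t hst => ?_⟩
  · rintro ⟨_, x, rfl⟩
    exact ⟨x, Subtype.ext (heval _ x)⟩
  · by_contra! hsep
    refine hst (Subtype.ext (Set.ext fun z => ?_))
    have := hsep z
    rw [Language.mem_accept_toDFA, Language.mem_accept_toDFA, heval, heval,
      Language.mem_leftQuotient, Language.mem_leftQuotient, List.append_nil] at this
    exact this

theorem card_range_leftQuotient_le {σ : Type*} [Fintype σ] (M : DFA A σ) :
    Finite (Set.range M.accepts.leftQuotient) ∧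
      Nat.card (Set.range M.accepts.leftQuotient) ≤ Fintype.card σ := by
  have hsub : Set.range M.accepts.leftQuotient ⊆ Set.range M.acceptsFrom := by
    rw [Language.leftQuotient_accepts]
    exact Set.range_comp_subset_range _ _
  refine ⟨((Set.finite_range _).subset hsub), ?_⟩
  calc Nat.card (Set.range M.accepts.leftQuotient)
      ≤ Nat.card (Set.range M.acceptsFrom) := Nat.card_mono (Set.finite_range _) hsub
    _ ≤ Nat.card σ := Finite.card_range_le _
    _ = Fintype.card σ := Nat.card_eq_fintype_card

/-- If the alternation of the language of `M` is bounded, then membership only depends on the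
scattered subwords of length less than the number of states. -/
theorem mem_langOf_iff_of_subwordEquiv {σ : Type*} [Fintype σ] (M : DFA A σ)
    (h : ¬ ∀ m, (LPlus (LangOf M) m).Nonempty) {n : ℕ} (hn : Fintype.card σ ≤ n + 1)
    {u v : List A} (huv : SubwordEquiv n u v) : u ∈ LangOf M ↔ v ∈ LangOf M := by
  let N := Language.toDFA M.accepts
  have hL : LangOf N = LangOf M := Language.accepts_toDFA M.accepts
  obtain ⟨_, hcard⟩ := M.card_range_leftQuotient_le
  have hN : N.Reduced := reduced_toDFA _
  rw [← hL] at h ⊢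
  have hreach : (N.reach N.start).ncard ≤ n + 1 := by
    refine le_trans ?_ (hcard.trans hn)
    rw [← Set.ncard_univ]
    exact Set.ncard_le_ncard (Set.subset_univ _) (Set.toFinite _)
  have := (hN.acyclic h).evalFrom_eq (hN.confluent h) n N.start hreach huv
  change N.evalFrom N.start u ∈ N.accept ↔ N.evalFrom N.start v ∈ N.accept
  rw [this]

theorem LPlus_langOf_nonempty {σ : Type*} [Fintype A] [Fintype σ] (M : DFA A σ)
    (hne : (LPlus (LangOf M) (2 ^ (Fintype.card σ * (Fintype.card A) ^ 2) + 1)).Nonempty) :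
    ∀ m : ℕ, (LPlus (LangOf M) m).Nonempty := by
  by_contra h
  obtain ⟨_, c, _, hc, _, halt⟩ := hne
  obtain ⟨n, hn⟩ : ∃ n, Fintype.card σ = n + 1 :=
    Nat.exists_eq_succ_of_ne_zero (Fintype.card_pos_iff.2 ⟨M.start⟩).ne'
  have hbound : (Fintype.card A + 1) ^ (n + 1) < 2 ^ (Fintype.card σ * (Fintype.card A) ^ 2) + 1 := by
    rw [hn, Nat.lt_succ_iff]
    calc (Fintype.card A + 1) ^ (n + 1) ≤ (2 ^ Fintype.card A) ^ (n + 1) :=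
          Nat.pow_le_pow_left Nat.lt_two_pow_self _
      _ = 2 ^ ((n + 1) * Fintype.card A) := by rw [← pow_mul, mul_comm]
      _ ≤ 2 ^ ((n + 1) * Fintype.card A ^ 2) :=
          Nat.pow_le_pow_right two_pos
            (Nat.mul_le_mul_left _ (Nat.le_self_pow two_ne_zero _))
  obtain ⟨i, hi, hequiv⟩ := exists_subwordEquiv_of_chain c hc hbound
  have h₁ := halt i hi
  have h₂ := M.mem_langOf_iff_of_subwordEquiv h hn.le hequiv
  tauto

end DFA

/-- Stern's dichotomy: `m⁺(L(F))` is finite iff `m⁺(L(F)) ≤ 2^{|F|·|A|²}`.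
Equivalently: if `L(F)⁺(2^{|F|·|A|²} + 1) ≠ ∅` then `L(F)⁺(m) ≠ ∅` for all `m`. -/
theorem stmt14 {A σ : Type*} [Fintype A] [Fintype σ] (M : DFA A σ) :
    (mPlus (LangOf M) ≠ ⊤ ↔
      mPlus (LangOf M) ≤ ((2 ^ (Fintype.card σ * (Fintype.card A) ^ 2) : ℕ) : ℕ∞)) ∧
    ((LPlus (LangOf M) (2 ^ (Fintype.card σ * (Fintype.card A) ^ 2) + 1)).Nonempty →
      ∀ m : ℕ, (LPlus (LangOf M) m).Nonempty) := by
  have hdich := M.LPlus_langOf_nonempty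
  refine ⟨⟨fun h => ?_, fun h => ne_top_of_le_ne_top (ENat.natCast_ne_top _) h⟩, hdich⟩
  exact mPlus_le_of_LPlus_eq_empty fun hne => h (mPlus_eq_top (hdich hne))
end

section
/- Let F be a deterministic finite automaton over a finite alphabet A and let F̂ be a deterministic finite automaton with L(F̂) = L(F)^R, the language of reverses of words in L(F). Then the following are equivalent: (1) L(F) ∈ L_1 = BC(L_{1/2}); (2) neither F nor F̂ has pattern P_1; (3) neither F nor F̂ has pattern P_2. -/
/-- The boolean closure of a class `C`: the smallest class containing `C`
and closed under finite union, finite intersection and complementation. -/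
inductive BoolClosure {X : Type*} (C : Set (Set X)) : Set X → Prop
  | base : ∀ L ∈ C, BoolClosure C L
  | union : ∀ L M, BoolClosure C L → BoolClosure C M → BoolClosure C (L ∪ M)
  | inter : ∀ L M, BoolClosure C L → BoolClosure C M → BoolClosure C (L ∩ M)
  | compl : ∀ L, BoolClosure C L → BoolClosure C Lᶜ

/-- A DFA has pattern P₁ if there are words `v, x, y, z`, a letter `a` and
states `s₁, s₂, s₃` with `ya ⊑ v`, `δ*(s₀,x) = δ*(s₁,v) = s₁`, `δ*(s₁,y) = s₂`,
`δ(s₂,a) = s₃` and `δ*(s₂,z) ∈ S' ↔ δ*(s₃,z) ∉ S'`. -/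
def HasPatternP1 {A σ : Type*} (M : DFA A σ) : Prop :=
  ∃ (v x y z : List A) (a : A) (s1 s2 s3 : σ),
    (y ++ [a]).Sublist v ∧
    M.evalFrom M.start x = s1 ∧ M.evalFrom s1 v = s1 ∧
    M.evalFrom s1 y = s2 ∧ M.step s2 a = s3 ∧
    (M.evalFrom s2 z ∈ M.accept ↔ M.evalFrom s3 z ∉ M.accept)

/-- A DFA has pattern P₂ if there are words `u, x, z, z'`, a letter `a` and
states `s₁, s₂, s₃, s₄` with `az ⊑ u`, `δ*(s₀,x) = s₁`, `δ(s₁,a) = s₂`,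
`δ*(s₁,z) = δ*(s₃,u) = s₃`, `δ*(s₂,z) = δ*(s₄,u) = s₄` and
`δ*(s₃,z') ∈ S' ↔ δ*(s₄,z') ∉ S'`. -/
def HasPatternP2 {A σ : Type*} (M : DFA A σ) : Prop :=
  ∃ (u x z z' : List A) (a : A) (s1 s2 s3 s4 : σ),
    (a :: z).Sublist u ∧
    M.evalFrom M.start x = s1 ∧ M.step s1 a = s2 ∧
    M.evalFrom s1 z = s3 ∧ M.evalFrom s3 u = s3 ∧
    M.evalFrom s2 z = s4 ∧ M.evalFrom s4 u = s4 ∧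
    (M.evalFrom s3 z' ∈ M.accept ↔ M.evalFrom s4 z' ∉ M.accept)

/-- A DFA has pattern P₃ if there are words `u, v, x, y, z, z'`, a letter `a`
and states `s₁, …, s₅` with `ya ⊑ v` or `az ⊑ u`, `δ*(s₀,x) = δ*(s₁,v) = s₁`,
`δ*(s₁,y) = s₂`, `δ(s₂,a) = s₃`, `δ*(s₂,z) = δ*(s₄,u) = s₄`,
`δ*(s₃,z) = δ*(s₅,u) = s₅` and `δ*(s₄,z') ∈ S' ↔ δ*(s₅,z') ∉ S'`. -/
def HasPatternP3 {A σ : Type*} (M : DFA A σ) : Prop :=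
  ∃ (u v x y z z' : List A) (a : A) (s1 s2 s3 s4 s5 : σ),
    ((y ++ [a]).Sublist v ∨ (a :: z).Sublist u) ∧
    M.evalFrom M.start x = s1 ∧ M.evalFrom s1 v = s1 ∧
    M.evalFrom s1 y = s2 ∧ M.step s2 a = s3 ∧
    M.evalFrom s2 z = s4 ∧ M.evalFrom s4 u = s4 ∧
    M.evalFrom s3 z = s5 ∧ M.evalFrom s5 u = s5 ∧
    (M.evalFrom s4 z' ∈ M.accept ↔ M.evalFrom s5 z' ∉ M.accept)

/-- The residual of a language by a prefix. -/
def leftResidual {A : Type*} (L : Set (List A)) (u : List A) : Set (List A) :=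
  {z | u ++ z ∈ L}

/-- The residual of a language by a suffix. -/
def rightResidual {A : Type*} (L : Set (List A)) (v : List A) : Set (List A) :=
  {x | x ++ v ∈ L}

open Classical in
/-- The letters of a word, read from left to right, that change the current residual. -/
noncomputable def leftMarked {A : Type*} : Set (List A) → List A → List A
  | _, [] => []
  | L, x :: u =>
    if leftResidual L [x] = L then leftMarked L u else x :: leftMarked (leftResidual L [x]) u

open Classical in
/-- The letters of a word, read from right to left, that change the current residual by a
suffix. -/
noncomputable def rightMarked {A : Type*} (L : Set (List A)) : List A → List A
  | [] => []
  | x :: v =>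
    if rightResidual L (x :: v) = rightResidual L v then rightMarked L v else x :: rightMarked L v

/-- Membership in `L` only depends on the scattered subwords of length at most `k`. -/
def SubwordInvariant {A : Type*} (k : ℕ) (L : Set (List A)) : Prop :=
  ∀ u v : List A, (∀ w : List A, w.length ≤ k → (w.Sublist u ↔ w.Sublist v)) → (u ∈ L ↔ v ∈ L)

/-- Every letter of a word that fixes a residual of `L` fixes this residual. -/
def LoopLettersFix {A : Type*} (L : Set (List A)) : Prop :=
  ∀ (x v : List A) (a : A), a ∈ v → leftResidual L (x ++ v) = leftResidual L x →
    leftResidual L (x ++ [a]) = leftResidual L x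

section Residuals

variable {A : Type*}

theorem leftResidual_append (L : Set (List A)) (u v : List A) :
    leftResidual L (u ++ v) = leftResidual (leftResidual L u) v := by
  ext z; simp [leftResidual]

theorem leftResidual_cons (L : Set (List A)) (x : A) (u : List A) :
    leftResidual L (x :: u) = leftResidual (leftResidual L [x]) u :=
  leftResidual_append L [x] u

theorem leftResidual_nil (L : Set (List A)) : leftResidual L [] = L := by
  ext z; simp [leftResidual]

theorem rightResidual_cons_congr {L : Set (List A)} {u v : List A} (x : A)
    (h : rightResidual L u = rightResidual L v) :
    rightResidual L (x :: u) = rightResidual L (x :: v) := by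
  ext z
  have := Set.ext_iff.1 h (z ++ [x])
  simpa [rightResidual] using this

theorem leftMarked_append_singleton (L : Set (List A)) (u : List A) (x : A) :
    (leftResidual L (u ++ [x]) = leftResidual L u → leftMarked L (u ++ [x]) = leftMarked L u) ∧
    (leftResidual L (u ++ [x]) ≠ leftResidual L u →
      leftMarked L (u ++ [x]) = leftMarked L u ++ [x]) := by
  induction u generalizing L with
  | nil => simp +contextual [leftMarked, leftResidual_nil]
  | cons y u ih =>
    rw [List.cons_append, leftResidual_cons L y (u ++ [x]), leftResidual_cons L y u]
    by_cases h : leftResidual L [y] = L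
    · simpa [leftMarked, h] using ih L
    · simpa [leftMarked, h] using ih (leftResidual L [y])

theorem leftResidual_reverse (L : Set (List A)) (u : List A) :
    leftResidual {w | w.reverse ∈ L} u.reverse = List.reverse ⁻¹' rightResidual L u := by
  ext z; simp [leftResidual, rightResidual]

theorem length_rightMarked (L : Set (List A)) (v : List A) :
    (rightMarked L v).length = (leftMarked {w | w.reverse ∈ L} v.reverse).length := by
  induction v with
  | nil => simp [leftMarked, rightMarked]
  | cons x v ih =>
    have key : leftResidual {w | w.reverse ∈ L} (v.reverse ++ [x]) =
        leftResidual {w | w.reverse ∈ L} v.reverse ↔ rightResidual L (x :: v) = rightResidual L v := by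
      rw [← List.reverse_cons, leftResidual_reverse, leftResidual_reverse]
      exact (Set.preimage_injective.2 List.reverse_surjective).eq_iff
    obtain ⟨h₁, h₂⟩ := leftMarked_append_singleton {w | w.reverse ∈ L} v.reverse x
    rw [List.reverse_cons]
    by_cases h : rightResidual L (x :: v) = rightResidual L v
    · simp [rightMarked, h, h₁ (key.2 h), ih]
    · simp [rightMarked, h, h₂ (mt key.1 h), ih]

theorem LoopLettersFix.leftResidual {L : Set (List A)} (h : LoopLettersFix L) (u : List A) :
    LoopLettersFix (leftResidual L u) := by
  intro x v a ha hv
  simp only [← leftResidual_append] at hv ⊢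
  rw [← List.append_assoc] at hv ⊢
  exact h _ _ _ ha hv

theorem length_leftMarked_lt {L : Set (List A)} (h : LoopLettersFix L)
    (hfin : (Set.range (leftResidual L)).Finite) (u : List A) :
    (leftMarked L u).length < (Set.range (leftResidual L)).ncard := by
  induction u generalizing L with
  | nil => simpa [leftMarked] using (Set.ncard_pos hfin).2 (Set.range_nonempty _)
  | cons x u ih =>
    by_cases hx : leftResidual L [x] = L
    · simpa [leftMarked, hx] using ih h hfin
    · have hsub : Set.range (leftResidual (leftResidual L [x])) ⊆ Set.range (leftResidual L) := by
        rintro _ ⟨w, rfl⟩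
        exact ⟨[x] ++ w, leftResidual_append L [x] w⟩
      have hss : Set.range (leftResidual (leftResidual L [x])) ⊂ Set.range (leftResidual L) := by
        refine (Set.ssubset_iff_of_subset hsub).2 ⟨L, ⟨[], leftResidual_nil L⟩, ?_⟩
        rintro ⟨w, hw⟩
        refine hx ?_
        have := h [] (x :: w) x (by simp)
        simp only [List.nil_append, leftResidual_nil] at this
        exact this ((leftResidual_cons L x w).trans hw)
      have h₁ := ih (h.leftResidual [x]) (hfin.subset hsub)
      have h₂ := Set.ncard_lt_ncard hss hfin
      simp only [leftMarked, hx, if_false, List.length_cons]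
      omega

theorem not_cons_rightMarked_sublist {L : Set (List A)} {x : A} {v : List A}
    (h : rightResidual L (x :: v) ≠ rightResidual L v) : ¬ (x :: rightMarked L v).Sublist v := by
  induction v generalizing x with
  | nil => simp
  | cons y v ih =>
    by_cases hy : rightResidual L (y :: v) = rightResidual L v
    · have hxy : x ≠ y := by
        rintro rfl
        exact h (rightResidual_cons_congr x hy)
      rw [rightMarked, if_pos hy]
      intro hs
      refine ih ?_ (List.Sublist.of_cons_of_ne hxy hs)
      rwa [← rightResidual_cons_congr x hy, ← hy]
    · rw [rightMarked, if_neg hy]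
      intro hs
      exact ih hy hs.of_cons_cons

theorem leftMarked_sublist (L : Set (List A)) (u : List A) : (leftMarked L u).Sublist u := by
  induction u generalizing L with
  | nil => simp [leftMarked]
  | cons x u ih =>
    rw [leftMarked]
    split
    · exact (ih L).cons x
    · exact (ih _).cons_cons x

theorem rightMarked_suffix_cons (L : Set (List A)) (x : A) (v : List A) :
    rightMarked L v <:+ rightMarked L (x :: v) := by
  rw [rightMarked]
  split
  · exact List.suffix_rfl
  · exact List.suffix_cons x _

theorem rightMarked_sublist (L : Set (List A)) (v : List A) : (rightMarked L v).Sublist v := by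
  induction v with
  | nil => simp [rightMarked]
  | cons x v ih =>
    rw [rightMarked]
    split
    · exact ih.cons x
    · exact ih.cons_cons x

theorem ne_of_cons_prefix_leftMarked {L : Set (List A)} {u p : List A} {x y : A}
    (hp : y :: p <+: leftMarked L u) (hx : leftResidual L [x] = L) : y ≠ x := by
  induction u with
  | nil => simp [leftMarked] at hp
  | cons z u ih =>
    rw [leftMarked] at hp
    split at hp
    · exact ih hp
    · rename_i hz
      rw [List.cons_prefix_cons] at hp
      rintro rfl
      exact hz (hp.1 ▸ hx)

/-- If `u` and `v` contain the same concatenations of a prefix of the left marked letters of `u`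
and a suffix of the right marked letters of `v`, then erasing unmarked letters turns them into a
common word. -/
theorem exists_leftResidual_eq_and_rightResidual_eq (L : Set (List A)) (n : ℕ) :
    ∀ (s : Set (List A)) (u v : List A), u.length + v.length = n →
    (∀ p q : List A, p <+: leftMarked s u → q <:+ rightMarked L v →
      ((p ++ q).Sublist u ↔ (p ++ q).Sublist v)) →
    ∃ c, leftResidual s c = leftResidual s u ∧ rightResidual L c = rightResidual L v := by
  induction n using Nat.strong_induction_on with
  | _ n ih =>
    intro s u v hn H
    have hl : (leftMarked s u).Sublist v := by
      have := H _ [] List.prefix_rfl List.nil_suffix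
      simpa [leftMarked_sublist] using this
    have hr : (rightMarked L v).Sublist u := by
      have := H [] _ (by simp) List.suffix_rfl
      simpa [rightMarked_sublist] using this
    by_cases hu : ∃ x u', u = x :: u' ∧ leftResidual s [x] = s ∧ (rightMarked L v).Sublist u'
    · obtain ⟨x, u, rfl, hx, hs⟩ := hu
      have hm : leftMarked s (x :: u) = leftMarked s u := by simp [leftMarked, hx]
      obtain ⟨c, h₁, h₂⟩ := ih (u.length + v.length) (by simp at hn; omega) s u v rfl (by
        intro p q hp hq
        rw [← H p q (hm ▸ hp) hq]
        cases p with
        | nil => simp [hq.sublist.trans hs, (hq.sublist.trans hs).cons x]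
        | cons y p =>
          have hyx : y ≠ x := ne_of_cons_prefix_leftMarked hp hx
          exact ⟨fun h => h.cons x, fun h => h.of_cons_of_ne hyx⟩)
      exact ⟨c, by rw [h₁, leftResidual_cons s, hx], h₂⟩
    by_cases hv : ∃ y v', v = y :: v' ∧ rightResidual L (y :: v') = rightResidual L v' ∧
        ∀ p, leftMarked s u ≠ y :: p
    · obtain ⟨y, v, rfl, hy, hs⟩ := hv
      have hm : rightMarked L (y :: v) = rightMarked L v := by simp [rightMarked, hy]
      obtain ⟨c, h₁, h₂⟩ := ih (u.length + v.length) (by simp at hn; omega) s u v rfl (by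
        intro p q hp hq
        rw [H p q hp (hm ▸ hq)]
        cases p with
        | nil =>
          have := hq.sublist.trans (rightMarked_sublist L v)
          simp [this, this.cons y]
        | cons x p =>
          have hxy : x ≠ y := by
            rintro rfl
            obtain ⟨t, ht⟩ := hp
            exact hs _ ht.symm
          exact ⟨fun h => h.of_cons_of_ne hxy, fun h => h.cons y⟩)
      exact ⟨c, h₁, h₂.trans hy.symm⟩
    push Not at hu hv
    rcases u with _ | ⟨x, u⟩
    · rcases v with _ | ⟨y, v⟩
      · exact ⟨[], rfl, rfl⟩
      · by_cases hy : rightResidual L (y :: v) = rightResidual L v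
        · obtain ⟨p, hp⟩ := hv y v rfl hy
          simp [leftMarked] at hp
        · simp [rightMarked, hy] at hr
    rcases v with _ | ⟨y, v⟩
    · by_cases hx : leftResidual s [x] = s
      · exact absurd (by simp [rightMarked]) (hu x u rfl hx)
      · simp [leftMarked, hx] at hl
    by_cases hxy : x = y
    · subst hxy
      obtain ⟨c, h₁, h₂⟩ := ih (u.length + v.length) (by simp at hn; omega)
        (leftResidual s [x]) u v rfl (by
        intro p q hp hq
        have hq' : q <:+ rightMarked L (x :: v) := hq.trans (rightMarked_suffix_cons L x v)
        by_cases hx : leftResidual s [x] = s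
        · have hm : leftMarked s (x :: u) = leftMarked s u := by simp [leftMarked, hx]
          rw [hx] at hp
          cases p with
          | nil =>
            have h₁ := hq.sublist.trans (rightMarked_sublist L v)
            have h₂ : rightResidual L (x :: v) ≠ rightResidual L v := by
              intro h
              obtain ⟨p, hp⟩ := hv x v rfl h
              rw [hm] at hp
              exact ne_of_cons_prefix_leftMarked (p := p) (by rw [hp]) hx rfl
            rw [rightMarked, if_neg h₂, List.cons_sublist_cons] at hr
            simp [h₁, hq.sublist.trans hr]
          | cons y p =>
            have hyx : y ≠ x := ne_of_cons_prefix_leftMarked hp hx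
            have := H (y :: p) q (hm ▸ hp) hq'
            exact ⟨fun h => (this.1 (h.cons x)).of_cons_of_ne hyx,
              fun h => (this.2 (h.cons x)).of_cons_of_ne hyx⟩
        · have hm : leftMarked s (x :: u) = x :: leftMarked (leftResidual s [x]) u := by
            simp [leftMarked, hx]
          have := H (x :: p) q (by rw [hm]; exact (List.prefix_cons_inj x).2 hp) hq'
          simpa only [List.cons_append, List.cons_sublist_cons] using this)
      exact ⟨x :: c, by rw [leftResidual_cons s, h₁, ← leftResidual_cons s],
        rightResidual_cons_congr x h₂⟩
    exfalso
    by_cases hx : leftResidual s [x] = s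
    · have hns := hu x u rfl hx
      by_cases hy : rightResidual L (y :: v) = rightResidual L v
      · obtain ⟨p, hp⟩ := hv y v rfl hy
        have h := H [y] _ (by simp [hp]) List.suffix_rfl
        have hs : (rightMarked L (y :: v)).Sublist v := by
          simpa [rightMarked, hy] using rightMarked_sublist L v
        simp only [List.singleton_append, List.cons_sublist_cons, hs, iff_true] at h
        exact hns h.of_cons_cons
      · rw [rightMarked, if_neg hy] at hr hns
        exact hns (hr.of_cons_of_ne (Ne.symm hxy))
    · by_cases hy : rightResidual L (y :: v) = rightResidual L v
      · obtain ⟨p, hp⟩ := hv y v rfl hy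
        simp only [leftMarked, hx, if_false, List.cons.injEq] at hp
        exact hxy hp.1
      · have h := H [x] _ (by simp [leftMarked, hx]) List.suffix_rfl
        rw [rightMarked, if_neg hy] at hr h
        have h' := h.1 ((hr.of_cons_of_ne (Ne.symm hxy)).cons_cons x)
        exact not_cons_rightMarked_sublist hy
          ((List.sublist_cons_self x _).trans (h'.of_cons_of_ne hxy))

/-- A form of Simon's theorem for languages with finitely many residuals. -/
theorem exists_subwordInvariant {L : Set (List A)}
    (hl : LoopLettersFix L) (hr : LoopLettersFix {w | w.reverse ∈ L})
    (hlf : (Set.range (leftResidual L)).Finite)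
    (hrf : (Set.range (leftResidual {w | w.reverse ∈ L})).Finite) :
    ∃ k, SubwordInvariant k L := by
  refine ⟨(Set.range (leftResidual L)).ncard +
    (Set.range (leftResidual {w | w.reverse ∈ L})).ncard, fun u v h => ?_⟩
  obtain ⟨c, h₁, h₂⟩ := exists_leftResidual_eq_and_rightResidual_eq L _ L u v rfl (by
    intro p q hp hq
    apply h
    have h₁ := length_leftMarked_lt hl hlf u
    have h₂ := length_leftMarked_lt hr hrf v.reverse
    rw [← length_rightMarked] at h₂
    have h₃ := hp.length_le
    have h₄ := hq.length_le
    rw [List.length_append]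
    omega)
  have h₃ := Set.ext_iff.1 h₁ []
  have h₄ := Set.ext_iff.1 h₂ []
  simp only [leftResidual, rightResidual, Set.mem_ofPred_eq, List.append_nil,
    List.nil_append] at h₃ h₄
  exact h₃.symm.trans h₄

end Residuals

section SubwordInvariant

variable {A : Type*}

theorem SubwordInvariant.mono {k l : ℕ} {L : Set (List A)} (h : SubwordInvariant k L)
    (hkl : k ≤ l) : SubwordInvariant l L :=
  fun u v huv => h u v fun w hw => huv w (hw.trans hkl)

theorem SubwordInvariant.reverse {k : ℕ} {L : Set (List A)} (h : SubwordInvariant k L) :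
    SubwordInvariant k {w | w.reverse ∈ L} := by
  intro u v huv
  refine h _ _ fun w hw => ?_
  have := huv w.reverse (by simpa using hw)
  simpa only [← List.reverse_sublist (l₁ := w.reverse), List.reverse_reverse] using this

theorem BoolClosure.exists_subwordInvariant {L : Set (List A)}
    (h : BoolClosure (LhalfClass A) L) : ∃ k, SubwordInvariant k L := by
  induction h with
  | base L hL =>
    obtain ⟨W, rfl⟩ := hL
    refine ⟨W.sup List.length, fun u v huv => ?_⟩
    simp only [Set.mem_iUnion, Set.mem_ofPred_eq, exists_prop]
    exact exists_congr fun w => and_congr_right fun hw => huv w (Finset.le_sup hw)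
  | union L M _ _ ihL ihM =>
    obtain ⟨k, hk⟩ := ihL
    obtain ⟨l, hl⟩ := ihM
    exact ⟨max k l, fun u v huv => or_congr (hk.mono (le_max_left k l) u v huv)
      (hl.mono (le_max_right k l) u v huv)⟩
  | inter L M _ _ ihL ihM =>
    obtain ⟨k, hk⟩ := ihL
    obtain ⟨l, hl⟩ := ihM
    exact ⟨max k l, fun u v huv => and_congr (hk.mono (le_max_left k l) u v huv)
      (hl.mono (le_max_right k l) u v huv)⟩
  | compl L _ ih =>
    obtain ⟨k, hk⟩ := ih
    exact ⟨k, fun u v huv => not_congr (hk u v huv)⟩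

theorem boolClosure_of_finset_invariant (W : Finset (List A)) :
    ∀ L : Set (List A),
      (∀ u v : List A, (∀ w ∈ W, (w.Sublist u ↔ w.Sublist v)) → (u ∈ L ↔ v ∈ L)) →
      BoolClosure (LhalfClass A) L := by
  classical
  induction W using Finset.induction_on with
  | empty =>
    intro L hL
    have hempty : BoolClosure (LhalfClass A) ∅ := .base _ ⟨∅, by simp⟩
    by_cases h : [] ∈ L
    · rw [show L = ∅ᶜ by ext u; simpa using (hL u [] (by simp)).2 h]
      exact hempty.compl
    · rw [show L = ∅ by ext u; simpa using mt (hL u [] (by simp)).1 h]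
      exact hempty
  | insert w W _ ih =>
    intro L hL
    have hw : BoolClosure (LhalfClass A) {v | w.Sublist v} := .base _ ⟨{w}, by simp⟩
    have hsat : ∀ P : List A → Prop, BoolClosure (LhalfClass A)
        {v | ∃ v' ∈ L, P v' ∧ ∀ x ∈ W, (x.Sublist v ↔ x.Sublist v')} := by
      refine fun P => ih _ fun u v huv => ?_
      simp only [Set.mem_ofPred_eq]
      refine exists_congr fun v' => and_congr_right fun _ => and_congr_right fun _ =>
        forall₂_congr fun x hx => ?_
      rw [huv x hx]
    have hdecomp : L =
        {v | w.Sublist v} ∩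
          {v | ∃ v' ∈ L, w.Sublist v' ∧ ∀ x ∈ W, (x.Sublist v ↔ x.Sublist v')} ∪
        {v | w.Sublist v}ᶜ ∩
          {v | ∃ v' ∈ L, ¬ w.Sublist v' ∧ ∀ x ∈ W, (x.Sublist v ↔ x.Sublist v')} := by
      ext v
      simp only [Set.mem_union, Set.mem_inter_iff, Set.mem_compl_iff, Set.mem_ofPred_eq]
      constructor
      · intro hv
        by_cases h : w.Sublist v
        · exact .inl ⟨h, v, hv, h, fun _ _ => Iff.rfl⟩
        · exact .inr ⟨h, v, hv, h, fun _ _ => Iff.rfl⟩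
      · rintro (⟨h, v', hv', h', hW⟩ | ⟨h, v', hv', h', hW⟩)
        · exact (hL v v' (by simpa [h, h'] using hW)).2 hv'
        · exact (hL v v' (by simpa [h, h'] using hW)).2 hv'
    rw [hdecomp]
    exact (hw.inter _ _ (hsat _)).union _ _ (hw.compl.inter _ _ (hsat _))

theorem SubwordInvariant.boolClosure [Finite A] {k : ℕ} {L : Set (List A)}
    (h : SubwordInvariant k L) : BoolClosure (LhalfClass A) L :=
  boolClosure_of_finset_invariant (List.finite_length_le A k).toFinset L
    fun u v huv => h u v (by simpa using huv)

theorem sublist_flatten_replicate {v w : List A} {k : ℕ} (hk : w.length ≤ k)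
    (hw : ∀ a ∈ w, a ∈ v) : w.Sublist (List.replicate k v).flatten := by
  induction k generalizing w with
  | zero => simp [List.length_eq_zero_iff.1 (Nat.le_zero.1 hk)]
  | succ k ih =>
    cases w with
    | nil => simp
    | cons a w =>
      simp only [List.length_cons, Nat.add_le_add_iff_right] at hk
      have h₁ : [a].Sublist v := List.singleton_sublist.2 (hw a (by simp))
      have h₂ := ih hk fun b hb => hw b (List.mem_cons_of_mem a hb)
      simpa [List.replicate_succ] using h₁.append h₂

theorem SubwordInvariant.mem_iff_of_power {k : ℕ} {L : Set (List A)} (h : SubwordInvariant k L)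
    {p q v : List A} (hp : ∀ a ∈ p, a ∈ v) (hq : ∀ a ∈ q, a ∈ v) (x z : List A) :
    x ++ (p ++ (List.replicate k v).flatten ++ q) ++ z ∈ L ↔
      x ++ (List.replicate k v).flatten ++ z ∈ L := by
  refine h _ _ fun w hw => ⟨fun hs => ?_, fun hs => hs.trans ?_⟩
  · obtain ⟨w₁, w₃, rfl, hw₁, hw₃⟩ := List.sublist_append_iff.1 hs
    obtain ⟨w₁, w₂, rfl, hw₁, hw₂⟩ := List.sublist_append_iff.1 hw₁
    refine (hw₁.append (sublist_flatten_replicate ?_ fun a ha => ?_)).append hw₃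
    · simp only [List.length_append] at hw
      omega
    · have := hw₂.subset ha
      simp only [List.mem_append, List.mem_flatten, List.mem_replicate] at this
      rcases this with (ha | ⟨l, ⟨-, rfl⟩, ha⟩) | ha
      exacts [hp a ha, ha, hq a ha]
  · refine ((List.Sublist.refl x).append ?_).append (List.Sublist.refl z)
    exact (List.sublist_append_right p _).trans (List.sublist_append_left _ q)

end SubwordInvariant

section Patterns

variable {A σ : Type*}

theorem mem_langOf (M : DFA A σ) (w : List A) :
    w ∈ LangOf M ↔ M.evalFrom M.start w ∈ M.accept :=
  Iff.rfl

theorem evalFrom_flatten_replicate (M : DFA A σ) (v : List A) (n : ℕ) (s : σ) :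
    M.evalFrom s (List.replicate n v).flatten = (fun t => M.evalFrom t v)^[n] s := by
  induction n generalizing s with
  | zero => simp
  | succ n ih => simp [List.replicate_succ, DFA.evalFrom_of_append, ih]

theorem evalFrom_flatten_replicate_of_loop (M : DFA A σ) {v : List A} {s : σ}
    (h : M.evalFrom s v = s) (n : ℕ) : M.evalFrom s (List.replicate n v).flatten = s := by
  rw [evalFrom_flatten_replicate]
  exact Function.iterate_fixed h n

/-- Some power of a word takes every state to a state on which a longer power loops. -/
theorem exists_evalFrom_loop [Finite σ] (M : DFA A σ) (v : List A) :
    ∃ n m, n < m ∧ ∀ s, M.evalFrom (M.evalFrom s (List.replicate n v).flatten)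
      (List.replicate m v).flatten = M.evalFrom s (List.replicate n v).flatten := by
  obtain ⟨i, j, hne, hij⟩ := Finite.exists_ne_map_eq_of_infinite
    fun n : ℕ => (fun t => M.evalFrom t v)^[n]
  wlog hlt : i < j generalizing i j
  · exact this j i hne.symm hij.symm (by omega)
  refine ⟨i, (j - i) * (i + 1), by nlinarith [Nat.sub_pos_of_lt hlt], fun s => ?_⟩
  simp only [evalFrom_flatten_replicate, Function.iterate_mul]
  refine Function.iterate_fixed ?_ _
  rw [← Function.iterate_add_apply, Nat.sub_add_cancel hlt.le]
  exact (congrFun hij s).symm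

theorem not_hasPatternP1_of_subwordInvariant {M : DFA A σ} {k : ℕ}
    (h : SubwordInvariant k (LangOf M)) : ¬ HasPatternP1 M := by
  rintro ⟨v, x, y, z, a, s₁, s₂, s₃, hs, rfl, hv, rfl, rfl, hz⟩
  have hloop := evalFrom_flatten_replicate_of_loop M hv k
  have hletters : ∀ b ∈ y ++ [a], b ∈ v := fun b hb => hs.subset hb
  have h₁ := h.mem_iff_of_power (p := []) (q := y) (v := v) (by simp)
    (fun b hb => hletters b (by simp [hb])) x z
  have h₂ := h.mem_iff_of_power (p := []) (q := y ++ [a]) (v := v) (by simp) hletters x z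
  simp only [mem_langOf, DFA.evalFrom_of_append, List.nil_append, hloop,
    DFA.evalFrom_singleton] at h₁ h₂
  tauto

theorem not_hasPatternP2_of_subwordInvariant {M : DFA A σ} {k : ℕ}
    (h : SubwordInvariant k (LangOf M)) : ¬ HasPatternP2 M := by
  rintro ⟨u, x, z, z', a, s₁, s₂, s₃, s₄, hs, rfl, rfl, rfl, h₃, rfl, h₄, hz⟩
  have hloop₃ := evalFrom_flatten_replicate_of_loop M h₃ k
  have hloop₄ := evalFrom_flatten_replicate_of_loop M h₄ k
  have hletters : ∀ b ∈ [a] ++ z, b ∈ u := fun b hb => hs.subset hb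
  have h₁ := h.mem_iff_of_power (p := z) (q := []) (v := u)
    (fun b hb => hletters b (by simp [hb])) (by simp) x z'
  have h₂ := h.mem_iff_of_power (p := [a] ++ z) (q := []) (v := u) hletters (by simp) x z'
  simp only [mem_langOf, DFA.evalFrom_of_append, List.append_nil, hloop₃, hloop₄,
    DFA.evalFrom_singleton] at h₁ h₂
  tauto

theorem exists_power_mem_iff_of_not_hasPatternP1 [Finite σ] {M : DFA A σ}
    (h : ¬ HasPatternP1 M) (x v z : List A) {a : A} (ha : a ∈ v) :
    ∃ n, x ++ (List.replicate n v).flatten ++ [a] ++ z ∈ LangOf M ↔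
      x ++ (List.replicate n v).flatten ++ z ∈ LangOf M := by
  obtain ⟨n, m, hnm, hloop⟩ := exists_evalFrom_loop M v
  refine ⟨n, ?_⟩
  by_contra hne
  refine h ⟨(List.replicate m v).flatten, x ++ (List.replicate n v).flatten, [], z, a, _, _, _,
    sublist_flatten_replicate (by simp; omega) (by simpa using ha), rfl, ?_, rfl, rfl, ?_⟩
  · rw [DFA.evalFrom_of_append, hloop]
  · simp only [mem_langOf, DFA.evalFrom_of_append, DFA.evalFrom_singleton,
      DFA.evalFrom_nil] at hne ⊢
    tauto

theorem exists_power_mem_iff_of_not_hasPatternP2 [Finite σ] {M : DFA A σ}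
    (h : ¬ HasPatternP2 M) (x v z : List A) {a : A} (ha : a ∈ v) :
    ∃ n, x ++ [a] ++ (List.replicate n v).flatten ++ z ∈ LangOf M ↔
      x ++ (List.replicate n v).flatten ++ z ∈ LangOf M := by
  obtain ⟨n, m, hnm, hloop⟩ := exists_evalFrom_loop M v
  refine ⟨n, ?_⟩
  by_contra hne
  refine h ⟨(List.replicate m v).flatten, x, (List.replicate n v).flatten, z, a, _, _, _, _,
    ?_, rfl, rfl, rfl, hloop _, rfl, hloop _, ?_⟩
  · obtain ⟨l, rfl⟩ := Nat.exists_eq_add_of_lt hnm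
    rw [show n + l + 1 = (l + 1) + n by omega, ← List.replicate_append_replicate,
      List.flatten_append]
    exact (sublist_flatten_replicate (w := [a]) (by simp) (by simpa using ha)).append
      (List.Sublist.refl _)
  · simp only [mem_langOf, DFA.evalFrom_of_append, DFA.evalFrom_singleton] at hne ⊢
    tauto

theorem loopLettersFix_of_power_mem_iff {L : Set (List A)}
    (h : ∀ (x v z : List A) (a : A), a ∈ v → ∃ n,
      x ++ (List.replicate n v).flatten ++ [a] ++ z ∈ L ↔
        x ++ (List.replicate n v).flatten ++ z ∈ L) : LoopLettersFix L := by
  intro x v a ha hv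
  have hpow : ∀ n, leftResidual L (x ++ (List.replicate n v).flatten) = leftResidual L x := by
    intro n
    induction n with
    | zero => simp
    | succ n ih =>
      rw [List.replicate_succ, List.flatten_cons, ← List.append_assoc, leftResidual_append, hv,
        ← leftResidual_append, ih]
  ext z
  obtain ⟨n, hn⟩ := h x v z a ha
  have h₁ := Set.ext_iff.1 (hpow n) z
  have h₂ := Set.ext_iff.1 (hpow n) ([a] ++ z)
  simp only [leftResidual, Set.mem_ofPred_eq, ← List.append_assoc] at h₁ h₂ ⊢
  rw [← h₁, ← h₂, hn]

theorem loopLettersFix_of_not_hasPatternP1 [Finite σ] {M : DFA A σ}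
    (h : ¬ HasPatternP1 M) : LoopLettersFix (LangOf M) :=
  loopLettersFix_of_power_mem_iff fun x v z _ ha =>
    exists_power_mem_iff_of_not_hasPatternP1 h x v z ha

theorem loopLettersFix_reverse_of_not_hasPatternP2 [Finite σ] {M : DFA A σ}
    (h : ¬ HasPatternP2 M) : LoopLettersFix {w | w.reverse ∈ LangOf M} := by
  refine loopLettersFix_of_power_mem_iff fun x v z a ha => ?_
  obtain ⟨n, hn⟩ := exists_power_mem_iff_of_not_hasPatternP2 h z.reverse v.reverse x.reverse
    (List.mem_reverse.2 ha)
  refine ⟨n, ?_⟩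
  simpa [List.reverse_flatten] using hn

theorem finite_range_leftResidual_langOf [Finite σ] (M : DFA A σ) :
    (Set.range (leftResidual (LangOf M))).Finite := by
  refine (Set.finite_range fun s => {z | M.evalFrom s z ∈ M.accept}).subset ?_
  rintro _ ⟨u, rfl⟩
  refine ⟨M.evalFrom M.start u, ?_⟩
  ext z
  simp [leftResidual, mem_langOf, DFA.evalFrom_of_append]

end Patterns

/-- Let `F̂` be a DFA with `L(F̂) = L(F)^R`. Then `L(F) ∈ L₁ = BC(L_{1/2})` iff
neither `F` nor `F̂` has pattern P₁, iff neither `F` nor `F̂` has pattern P₂. -/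
theorem stmt16 {A σ τ : Type*} [Fintype A] [Fintype σ] [Fintype τ]
    (M : DFA A σ) (N : DFA A τ)
    (hrev : LangOf N = {w : List A | w.reverse ∈ LangOf M}) :
    (BoolClosure (LhalfClass A) (LangOf M) ↔ (¬ HasPatternP1 M ∧ ¬ HasPatternP1 N)) ∧
    (BoolClosure (LhalfClass A) (LangOf M) ↔ (¬ HasPatternP2 M ∧ ¬ HasPatternP2 N)) := by
  have hrev' : LangOf M = {w : List A | w.reverse ∈ LangOf N} := by
    rw [hrev]; ext w; simp
  have hforward (h : BoolClosure (LhalfClass A) (LangOf M)) :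
      ∃ k, SubwordInvariant k (LangOf M) ∧ SubwordInvariant k (LangOf N) := by
    obtain ⟨k, hk⟩ := h.exists_subwordInvariant
    exact ⟨k, hk, hrev ▸ hk.reverse⟩
  have hbackward (hM : LoopLettersFix (LangOf M)) (hN : LoopLettersFix (LangOf N)) :
      BoolClosure (LhalfClass A) (LangOf M) := by
    obtain ⟨k, hk⟩ := exists_subwordInvariant hM (hrev ▸ hN)
      (finite_range_leftResidual_langOf M) (hrev ▸ finite_range_leftResidual_langOf N)
    exact hk.boolClosure
  refine ⟨⟨fun h => ?_, fun h => ?_⟩, ⟨fun h => ?_, fun h => ?_⟩⟩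
  · obtain ⟨k, hM, hN⟩ := hforward h
    exact ⟨not_hasPatternP1_of_subwordInvariant hM, not_hasPatternP1_of_subwordInvariant hN⟩
  · exact hbackward (loopLettersFix_of_not_hasPatternP1 h.1)
      (loopLettersFix_of_not_hasPatternP1 h.2)
  · obtain ⟨k, hM, hN⟩ := hforward h
    exact ⟨not_hasPatternP2_of_subwordInvariant hM, not_hasPatternP2_of_subwordInvariant hN⟩
  · refine hbackward ?_ ?_
    · rw [hrev']
      exact loopLettersFix_reverse_of_not_hasPatternP2 h.2
    · rw [hrev]
      exact loopLettersFix_reverse_of_not_hasPatternP2 h.1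
end

section
/- Let F be a deterministic finite automaton over a finite alphabet A that has pattern P_1. Then every deterministic finite automaton F̂ with L(F̂) = L(F)^R (the language of reverses of words in L(F)) has pattern P_2. -/
/-- Every self-map of a finite type has an idempotent positive iterate. -/
theorem exists_pos_iterate_add_self_eq {α : Type*} [Finite α] (f : α → α) :
    ∃ k, 0 < k ∧ f^[k + k] = f^[k] := by
  obtain ⟨i, j, hij, h⟩ : ∃ i j : ℕ, i < j ∧ f^[i] = f^[j] := by
    obtain ⟨i, j, hne, h⟩ := Finite.exists_ne_map_eq_of_infinite (fun n : ℕ => f^[n])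
    rcases lt_or_gt_of_ne hne with hlt | hlt
    · exact ⟨i, j, hlt, h⟩
    · exact ⟨j, i, hlt, h.symm⟩
  obtain ⟨p, rfl⟩ := Nat.exists_eq_add_of_lt hij
  have period (n : ℕ) (hn : i ≤ n) : f^[n + (p + 1)] = f^[n] := by
    obtain ⟨m, rfl⟩ := Nat.exists_eq_add_of_le hn
    rw [show i + m + (p + 1) = m + (i + p + 1) by ring, Function.iterate_add, ← h,
      ← Function.iterate_add, add_comm]
  have periods (n m : ℕ) (hn : i ≤ n) : f^[n + m * (p + 1)] = f^[n] := by
    induction m with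
    | zero => simp
    | succ m ih =>
      rw [show n + (m + 1) * (p + 1) = n + m * (p + 1) + (p + 1) by ring,
        period _ (by omega), ih]
  exact ⟨(i + 1) * (p + 1), by positivity, periods _ _ (by nlinarith)⟩

/-- The `n`-fold concatenation of a word with itself. -/
def wordPow {A : Type*} (w : List A) (n : ℕ) : List A :=
  (List.replicate n w).flatten

theorem wordPow_succ {A : Type*} (w : List A) (n : ℕ) :
    wordPow w (n + 1) = w ++ wordPow w n := by
  simp [wordPow, List.replicate_succ]

theorem wordPow_add {A : Type*} (w : List A) (m n : ℕ) :
    wordPow w (m + n) = wordPow w m ++ wordPow w n := by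
  rw [wordPow, ← List.replicate_append_replicate, List.flatten_append, wordPow, wordPow]

theorem reverse_wordPow {A : Type*} (w : List A) (n : ℕ) :
    (wordPow w n).reverse = wordPow w.reverse n := by
  simp [wordPow, List.reverse_flatten]

theorem evalFrom_wordPow {A σ : Type*} (M : DFA A σ) (w : List A) (n : ℕ) (s : σ) :
    M.evalFrom s (wordPow w n) = (fun t => M.evalFrom t w)^[n] s := by
  induction n generalizing s with
  | zero => simp [wordPow]
  | succ n ih => rw [wordPow_succ, DFA.evalFrom_of_append, ih, Function.iterate_succ_apply]

/-- Some positive power of any word acts idempotently on the states of a finite automaton. -/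
theorem exists_wordPow_evalFrom_idempotent {A σ : Type*} [Finite σ] (M : DFA A σ) (w : List A) :
    ∃ k, 0 < k ∧ ∀ s, M.evalFrom (M.evalFrom s (wordPow w k)) (wordPow w k) =
      M.evalFrom s (wordPow w k) := by
  obtain ⟨k, hk, h⟩ := exists_pos_iterate_add_self_eq (fun t => M.evalFrom t w)
  refine ⟨k, hk, fun s => ?_⟩
  rw [← DFA.evalFrom_of_append, ← wordPow_add, evalFrom_wordPow, evalFrom_wordPow]
  exact congrFun h s

theorem evalFrom_wordPow_of_loop {A σ : Type*} (M : DFA A σ) {w : List A} {s : σ}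
    (h : M.evalFrom s w = s) (n : ℕ) : M.evalFrom s (wordPow w n) = s := by
  rw [evalFrom_wordPow]
  exact Function.iterate_fixed h n

/-- If a DFA `F` has pattern P₁, then every DFA `F̂` with `L(F̂) = L(F)^R`
has pattern P₂. -/
theorem stmt18 {A σ : Type*} [Fintype A] [Fintype σ] (M : DFA A σ)
    (h : HasPatternP1 M) :
    ∀ (τ : Type) [Fintype τ] (N : DFA A τ),
      LangOf N = {w : List A | w.reverse ∈ LangOf M} → HasPatternP2 N := by
  rintro τ _ N hN
  obtain ⟨v, x, y, z, a, _, _, _, hsub, rfl, hv, rfl, rfl, hz⟩ := h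
  have mem_iff (w : List A) : N.eval w ∈ N.accept ↔ M.eval w.reverse ∈ M.accept :=
    Set.ext_iff.mp hN w
  obtain ⟨k, hk, hidem⟩ := exists_wordPow_evalFrom_idempotent N v.reverse
  have hloop (s : τ) : N.evalFrom (N.evalFrom s (y.reverse ++ wordPow v.reverse k))
      (wordPow v.reverse (k + k)) = N.evalFrom s (y.reverse ++ wordPow v.reverse k) := by
    simp only [wordPow_add, DFA.evalFrom_of_append, hidem]
  refine ⟨wordPow v.reverse (k + k), z.reverse, y.reverse ++ wordPow v.reverse k, x.reverse,
    a, _, _, _, _, ?_, rfl, rfl, rfl, hloop _, rfl, hloop _, ?_⟩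
  · have hay : (a :: y.reverse).Sublist v.reverse := by
      simpa using hsub.reverse
    obtain ⟨m, rfl⟩ := Nat.exists_eq_succ_of_ne_zero hk.ne'
    have hpow : v.reverse.Sublist (wordPow v.reverse (m + 1)) := by
      rw [wordPow_succ]
      exact List.sublist_append_left _ _
    rw [wordPow_add]
    exact (hay.trans hpow).append (List.Sublist.refl _)
  · have h₁ := mem_iff (z.reverse ++ (y.reverse ++ wordPow v.reverse k) ++ x.reverse)
    have h₂ := mem_iff (z.reverse ++ [a] ++ (y.reverse ++ wordPow v.reverse k) ++ x.reverse)
    simp only [List.reverse_append, List.reverse_reverse, reverse_wordPow, DFA.eval,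
      DFA.evalFrom_of_append, List.reverse_singleton, evalFrom_wordPow_of_loop M hv,
      DFA.evalFrom_singleton] at h₁ h₂
    simp only [DFA.evalFrom_of_append]
    rw [h₁, h₂]
    exact hz
end
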